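/- arXiv:2001.08117 — 2 statements merged into one kernel-verified Lean document; each statement's English description precedes it below -/
import Mathlib

section
/- (Transformation formula between ℱ^{(σ)} and ℱ̂^{(σ̂)}.) Let N ≥ 2 be an integer, p > N a prime, and a = m₀/N ∈ ℤ_p with m₀ ∈ ℤ, 0 < m₀ < N; take s = 2 throughout. Let r ≥ 1 be an integer with a^{(r)} = a and put h(t) := Π_{i=0}^{r−1} F_{a^{(i)},a^{(i)}}(t)_{<p}. Let c ∈ 1+pW, σ(t) = c t^p and σ̂(t) = c^{−1} t^p. Then ℱ^{(σ)}_{a,a}(t) = −ℱ̂^{(σ̂)}_{a,a}(t^{−1}) in W⟨t, t^{−1}, h(t)^{−1}⟩ := lim←_n R_n; concretely, for every n ≥ 1 the identity G^{(σ)}_{a,a}(t)_{<p^n} · ω_n(F_{a,a}(t)_{<p^n}) = −ω_n(Ĝ^{(σ̂)}_{a,a}(t)_{<p^n}) · F_{a,a}(t)_{<p^n} holds in R_n, where ω_n: R_n → R_n is the ring homomorphism with ω_n(f(t)) = f(t^{−1}). (Both F_{a,a}(t)_{<p^n} and ω_n(F_{a,a}(t)_{<p^n}) are units in R_n, so this is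 equivalent to the equality of the fractions.) -/
open scoped Classical

namespace HGP

/-- `𝔽̄_p`, an algebraic closure of the prime field `𝔽_p`. -/
abbrev Fbar (p : ℕ) [Fact p.Prime] : Type _ := AlgebraicClosure (ZMod p)

/-- `W = W(𝔽̄_p)`, the ring of Witt vectors of `𝔽̄_p`. -/
abbrev Wp (p : ℕ) [Fact p.Prime] : Type _ := WittVector p (Fbar p)

/-- `K = Frac W`. -/
abbrev Kp (p : ℕ) [Fact p.Prime] : Type _ := FractionRing (Wp p)

/-- The canonical embedding `ℤ_p = W(𝔽_p) → W(𝔽̄_p)`. -/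
noncomputable def iota (p : ℕ) [Fact p.Prime] : ℤ_[p] →+* Wp p :=
  (WittVector.map (algebraMap (ZMod p) (Fbar p))).comp (WittVector.equiv p).symm.toRingHom

/-- The canonical embedding `W → K`. -/
noncomputable def iotaK (p : ℕ) [Fact p.Prime] : Wp p →+* Kp p := algebraMap (Wp p) (Kp p)

/-- `l`: the unique integer in `{0,…,p−1}` with `a + l ≡ 0 mod p`. -/
noncomputable def dl (p : ℕ) [Fact p.Prime] (a : ℤ_[p]) : ℕ := (-a).appr 1

/-- `q := 4` if `p = 2` and `q := p` otherwise. -/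
def qq (p : ℕ) : ℕ := if p = 2 then 4 else p

/-- `l′`: the unique integer in `{0,…,q−1}` with `a + l′ ≡ 0 mod q`. -/
noncomputable def dl' (p : ℕ) [Fact p.Prime] (a : ℤ_[p]) : ℕ :=
  (-a).appr (if p = 2 then 2 else 1)

/-- `e := l′ − ⌊l′/p⌋`. -/
noncomputable def de (p : ℕ) [Fact p.Prime] (a : ℤ_[p]) : ℕ := dl' p a - dl' p a / p

/-- `a ∈ ℤ_p ∖ ℤ_{≤0}`, i.e. `a` is not a nonpositive rational integer. -/
def NotNonposInt (p : ℕ) [Fact p.Prime] (a : ℤ_[p]) : Prop := ∀ n : ℕ, a + (n : ℤ_[p]) ≠ 0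

/-- `a′` is the Dwork prime of `a`, i.e. `p·a′ = a + l`. -/
def IsDworkPrime (p : ℕ) [Fact p.Prime] (a a' : ℤ_[p]) : Prop :=
  (p : ℤ_[p]) * a' = a + (dl p a : ℤ_[p])

/-- `A k = ((a)_k / k!)^s ∈ ℤ_p`, characterized by `k!^s · A k = ((a)_k)^s`. -/
def IsHGCoeff (p : ℕ) [Fact p.Prime] (s : ℕ) (a : ℤ_[p]) (A : ℕ → ℤ_[p]) : Prop :=
  ∀ k : ℕ, (k.factorial : ℤ_[p]) ^ s * A k = ((ascPochhammer ℤ_[p] k).eval a) ^ s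

/-- `f = (α ↦ c^α)` for `c ∈ 1 + pW`: `c^α` is uniquely characterized by
`c^α ≡ c^{α_n} mod p^n W` for any natural approximation `α_n` of `α` mod `p^n`. -/
def IsCpow (p : ℕ) [Fact p.Prime] (c : Wp p) (f : ℤ_[p] → Wp p) : Prop :=
  ∀ (α : ℤ_[p]) (n : ℕ), f α - c ^ (α.appr n) ∈ Ideal.span {(p : Wp p) ^ n}

/-- The coefficients `B_k` of `Ĝ^{(σ)}_{a,…,a}(t)`, as elements of `K = Frac W`:
`B_k = (k+a)⁻¹ (A_k − (−1)^{se} A^{(1)}_{(k−l)/p} c^{(k−l)/p + a′})`. -/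
noncomputable def BhatK (p : ℕ) [Fact p.Prime] (s : ℕ) (a a' : ℤ_[p]) (A A1 : ℕ → ℤ_[p])
    (cpw : ℤ_[p] → Wp p) (k : ℕ) : Kp p :=
  ((k : Kp p) + iotaK p (iota p a))⁻¹ *
    (iotaK p (iota p (A k)) -
      (if dl p a ≤ k ∧ p ∣ (k - dl p a) then
        (-1 : Kp p) ^ (s * de p a) * iotaK p (iota p (A1 ((k - dl p a) / p))) *
          iotaK p (cpw ((((k - dl p a) / p : ℕ) : ℤ_[p]) + a'))
      else 0))

/-- `B : ℕ → W` is the coefficient function of `Ĝ^{(σ)}_{a,…,a}(t)`, characterized in `W` by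
`(k+a)·B_k = A_k − (−1)^{se} A^{(1)}_{(k−l)/p} c^{(k−l)/p + a′}`. -/
def IsBhat (p : ℕ) [Fact p.Prime] (s : ℕ) (a a' : ℤ_[p]) (A A1 : ℕ → ℤ_[p])
    (cpw : ℤ_[p] → Wp p) (B : ℕ → Wp p) : Prop :=
  ∀ k : ℕ, ((k : Wp p) + iota p a) * B k =
    iota p (A k) -
      (if dl p a ≤ k ∧ p ∣ (k - dl p a) then
        (-1 : Wp p) ^ (s * de p a) * iota p (A1 ((k - dl p a) / p)) *
          cpw ((((k - dl p a) / p : ℕ) : ℤ_[p]) + a')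
      else 0)

/-- A function `ℕ → K` is Lipschitz: it takes values in `W` and
`p^m ∣ (n − n′)` implies `f n − f n′ ∈ p^m W`. -/
def LipschitzSeq (p : ℕ) [Fact p.Prime] (f : ℕ → Kp p) : Prop :=
  (∀ n : ℕ, f n ∈ (iotaK p).range) ∧
    ∀ n n' m : ℕ, ((p : ℤ) ^ m ∣ (n : ℤ) - (n' : ℤ)) →
      ∃ w : Wp p, f n - f n' = (p : Kp p) ^ m * iotaK p w

/-- `L` is the `p`-adic limit of the sequence `s` in `W`. -/
def WLim (p : ℕ) [Fact p.Prime] (s : ℕ → Wp p) (L : Wp p) : Prop :=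
  ∀ m : ℕ, ∃ M : ℕ, ∀ n ≥ M, L - s n ∈ Ideal.span {(p : Wp p) ^ m}

/-- `{α}_k := Π_{1 ≤ i ≤ k, p ∤ (α+i−1)} (α+i−1)`. -/
noncomputable def curly (p : ℕ) [Fact p.Prime] (α : ℤ_[p]) (k : ℕ) : ℤ_[p] :=
  ∏ j ∈ Finset.range k, if (p : ℤ_[p]) ∣ (α + (j : ℤ_[p])) then 1 else (α + (j : ℤ_[p]))

/-- `W/p^n W`. -/
abbrev Qn (p : ℕ) [Fact p.Prime] (n : ℕ) := Wp p ⧸ Ideal.span {(p : Wp p) ^ n}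

/-- Laurent polynomials over `W/p^n`, obtained from polynomials over `W`. -/
noncomputable def laurentOfPolyW (p : ℕ) [Fact p.Prime] (n : ℕ) :
    Polynomial (Wp p) →+* LaurentPolynomial (Qn p n) :=
  (Polynomial.toLaurent).comp
    (Polynomial.mapRingHom (Ideal.Quotient.mk (Ideal.span {(p : Wp p) ^ n})))

/-- `R_n := (W/p^n)[t,t⁻¹, h(t)⁻¹]`, the localization of the Laurent polynomial ring
over `W/p^n` away from (the image of) `h`. -/
abbrev Rn (p : ℕ) [Fact p.Prime] (h : Polynomial (Wp p)) (n : ℕ) :=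
  Localization.Away (laurentOfPolyW p n h)

/-- The canonical map from Laurent polynomials over `W/p^n` to `R_n`. -/
noncomputable def mkRn (p : ℕ) [Fact p.Prime] (h : Polynomial (Wp p)) (n : ℕ) :
    LaurentPolynomial (Qn p n) →+* Rn p h n := algebraMap _ _

/-- The canonical map from polynomials over `W` to `R_n`. -/
noncomputable def toRn (p : ℕ) [Fact p.Prime] (h : Polynomial (Wp p)) (n : ℕ) :
    Polynomial (Wp p) →+* Rn p h n := (mkRn p h n).comp (laurentOfPolyW p n)



section part1
variable {p : ℕ} [Fact p.Prime]

lemma dl_lt (a : ℤ_[p]) : dl p a < p := by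
  have := PadicInt.appr_lt (-a) 1
  simpa [dl] using this

lemma dvd_add_dl (a : ℤ_[p]) : (p : ℤ_[p]) ∣ a + (dl p a : ℤ_[p]) := by
  have := PadicInt.appr_spec 1 (-a)
  rw [pow_one, Ideal.mem_span_singleton] at this
  have h2 := (dvd_neg.mpr this)
  unfold dl
  convert h2 using 1
  ring

lemma pdvd_nat (S n : ℕ) : (p : ℤ_[p]) ^ S ∣ (n : ℤ_[p]) ↔ p ^ S ∣ n := by
  have := PadicInt.pow_p_dvd_int_iff (p := p) S (n : ℤ)
  rw [Int.cast_natCast] at this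
  rw [this]
  exact_mod_cast Iff.rfl

lemma pdvd_nat1 (n : ℕ) : (p : ℤ_[p]) ∣ (n : ℤ_[p]) ↔ p ∣ n := by
  have := pdvd_nat (p := p) 1 n
  simpa using this

lemma isUnit_of_not_dvd {x : ℤ_[p]} (h : ¬ (p : ℤ_[p]) ∣ x) : IsUnit x := by
  by_contra hx
  exact h ((PadicInt.norm_lt_one_iff_dvd x).1 (PadicInt.not_isUnit_iff.1 hx))

lemma dvd_add_nat_iff (a : ℤ_[p]) (n : ℕ) :
    (p : ℤ_[p]) ∣ a + (n : ℤ_[p]) ↔ p ∣ n + p - dl p a := by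
  have hl := dl_lt a
  have h0 := dvd_add_dl a
  rw [← pdvd_nat1 (p := p), Nat.cast_sub (by omega)]
  push_cast
  have : a + (n : ℤ_[p]) = ((n : ℤ_[p]) + p - (dl p a : ℤ_[p])) + (a + (dl p a : ℤ_[p])) - p := by ring
  rw [this]
  constructor
  · intro h
    have h3 := dvd_add (dvd_sub h h0) (dvd_refl (p : ℤ_[p]))
    convert h3 using 1
    ring
  · intro h
    exact dvd_sub (dvd_add h h0) (dvd_refl _)

lemma mul_congr {R : Type*} [CommRing R] {d a b a' b' : R} (h : d ∣ a - b) (h' : d ∣ a' - b') :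
    d ∣ a * a' - b * b' := by
  have : a * a' - b * b' = (a - b) * a' + b * (a' - b') := by ring
  rw [this]
  exact dvd_add (Dvd.dvd.mul_right h _) (Dvd.dvd.mul_left h' _)

lemma unit_cancel {R : Type*} [CommRing R] {d a b c : R} (hc : IsUnit c) (h : d ∣ a * c - b * c) :
    d ∣ a - b := by
  rw [← sub_mul] at h
  exact (IsUnit.dvd_mul_right hc).1 h

lemma congr_trans {R : Type*} [CommRing R] {d a b c : R} (h : d ∣ a - b) (h' : d ∣ b - c) :
    d ∣ a - c := by
  have := dvd_add h h'
  simpa using this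

lemma congr_symm {R : Type*} [CommRing R] {d a b : R} (h : d ∣ a - b) : d ∣ b - a := by
  rw [← neg_sub]; exact (dvd_neg).2 h

/-- The `p`-prime part of `α`. -/
noncomputable def sharp (p : ℕ) [Fact p.Prime] (α : ℤ_[p]) : ℤ_[p] := if (p : ℤ_[p]) ∣ α then 1 else α

lemma isUnit_sharp (α : ℤ_[p]) : IsUnit (sharp p α) := by
  unfold sharp
  split_ifs with h
  · exact isUnit_one
  · exact isUnit_of_not_dvd h

lemma sharp_congr {S : ℕ} (hS : 1 ≤ S) {α β : ℤ_[p]} (h : (p : ℤ_[p]) ^ S ∣ α - β) :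
    (p : ℤ_[p]) ^ S ∣ sharp p α - sharp p β := by
  have h1 : (p : ℤ_[p]) ∣ α - β := (dvd_pow_self _ (by omega)).trans h
  unfold sharp
  have : (p : ℤ_[p]) ∣ α ↔ (p : ℤ_[p]) ∣ β := by
    constructor
    · intro h2; simpa using dvd_sub h2 h1
    · intro h2; simpa using dvd_add h1 h2
  by_cases hb : (p : ℤ_[p]) ∣ β
  · simp [hb, this.2 hb]
  · have : ¬ (p : ℤ_[p]) ∣ α := fun hh => hb (this.1 hh)
    simpa [hb, this] using h

lemma curly_eq (α : ℤ_[p]) (k : ℕ) :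
    curly p α k = ∏ j ∈ Finset.range k, sharp p (α + (j : ℤ_[p])) := rfl

@[simp] lemma curly_zero (α : ℤ_[p]) : curly p α 0 = 1 := by simp [curly_eq]

lemma curly_succ (α : ℤ_[p]) (k : ℕ) :
    curly p α (k + 1) = curly p α k * sharp p (α + (k : ℤ_[p])) := by
  simp [curly_eq, Finset.prod_range_succ]

lemma curly_add (α : ℤ_[p]) (m n : ℕ) :
    curly p α (m + n) = curly p α m * curly p (α + (m : ℤ_[p])) n := by
  simp only [curly_eq, Finset.prod_range_add]
  congr 1
  apply Finset.prod_congr rfl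
  intro j _
  push_cast
  rw [add_assoc]

lemma isUnit_curly (α : ℤ_[p]) (k : ℕ) : IsUnit (curly p α k) := by
  induction k with
  | zero => simp
  | succ k ih => rw [curly_succ]; exact ih.mul (isUnit_sharp _)

lemma curly_congr {S : ℕ} (hS : 1 ≤ S) {α β : ℤ_[p]} (h : (p : ℤ_[p]) ^ S ∣ α - β) (k : ℕ) :
    (p : ℤ_[p]) ^ S ∣ curly p α k - curly p β k := by
  induction k with
  | zero => simp
  | succ k ih =>
    rw [curly_succ, curly_succ]
    refine mul_congr ih (sharp_congr hS ?_)
    simpa using h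

lemma curly_pow_shift {S : ℕ} (hS : 1 ≤ S) (α : ℤ_[p]) :
    (p : ℤ_[p]) ^ S ∣ curly p (α + 1) (p ^ S) - curly p α (p ^ S) := by
  have h1 : curly p α (1 + p ^ S) = sharp p α * curly p (α + 1) (p ^ S) := by
    rw [curly_add, show (1 : ℕ) = 0 + 1 from rfl, curly_succ]
    simp
  have h2 : curly p α (1 + p ^ S) = curly p α (p ^ S) * sharp p (α + ((p ^ S : ℕ) : ℤ_[p])) := by
    rw [add_comm, curly_succ]
  apply unit_cancel (isUnit_sharp α)
  have h3 : (p : ℤ_[p]) ^ S ∣ sharp p (α + ((p ^ S : ℕ) : ℤ_[p])) - sharp p α := by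
    apply sharp_congr hS
    simp
  rw [mul_comm _ (sharp p α), ← h1, h2, ← mul_sub]
  exact Dvd.dvd.mul_left h3 _

lemma curly_pow_nat {S : ℕ} (hS : 1 ≤ S) (m : ℕ) :
    (p : ℤ_[p]) ^ S ∣ curly p (m : ℤ_[p]) (p ^ S) - curly p 0 (p ^ S) := by
  induction m with
  | zero => simp
  | succ m ih =>
    push_cast
    exact congr_trans (curly_pow_shift hS _) ih

lemma curly_pow {S : ℕ} (hS : 1 ≤ S) (α : ℤ_[p]) :
    (p : ℤ_[p]) ^ S ∣ curly p α (p ^ S) - curly p 0 (p ^ S) := by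
  have h := PadicInt.appr_spec S α
  rw [Ideal.mem_span_singleton] at h
  exact congr_trans (curly_congr hS h _) (curly_pow_nat hS _)

lemma curly_pow_mul {S : ℕ} (hS : 1 ≤ S) (α : ℤ_[p]) (t : ℕ) :
    (p : ℤ_[p]) ^ S ∣ curly p α (p ^ S * t) - curly p 0 (p ^ S) ^ t := by
  induction t with
  | zero => simp
  | succ t ih =>
    rw [mul_add, mul_one, curly_add, pow_succ]
    exact mul_congr ih (curly_pow hS _)

/-- inverse of a curly symbol -/
noncomputable def cinv (p : ℕ) [Fact p.Prime] (α : ℤ_[p]) (k : ℕ) : ℤ_[p] :=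
  ((isUnit_curly (p := p) α k).unit⁻¹ : ℤ_[p]ˣ)

lemma curly_mul_cinv (α : ℤ_[p]) (k : ℕ) : curly p α k * cinv p α k = 1 := by
  unfold cinv
  exact IsUnit.mul_val_inv _

lemma isUnit_cinv (α : ℤ_[p]) (k : ℕ) : IsUnit (cinv p α k) := Units.isUnit _

/-- the ratio `{α}_n/{1}_n` is locally constant -/
lemma ratio_congr_add {S : ℕ} (hS : 1 ≤ S) (α β : ℤ_[p]) (n t : ℕ) :
    (p : ℤ_[p]) ^ S ∣ curly p α (n + p ^ S * t) * cinv p β (n + p ^ S * t)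
      - curly p α n * cinv p β n := by
  have h1 := curly_pow_mul hS (α + (n : ℤ_[p])) t
  have h2 := curly_pow_mul hS (β + (n : ℤ_[p])) t
  have h3 := congr_trans h1 (congr_symm h2)
  apply unit_cancel (isUnit_curly β (n + p ^ S * t))
  apply unit_cancel (isUnit_curly β n)
  have e1 := curly_mul_cinv β (n + p ^ S * t)
  have e2 := curly_mul_cinv β n
  have : curly p α (n + p ^ S * t) * cinv p β (n + p ^ S * t) * curly p β (n + p ^ S * t) * curly p β n
      - curly p α n * cinv p β n * curly p β (n + p ^ S * t) * curly p β n =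
      curly p α (n + p ^ S * t) * curly p β n * (curly p β (n + p ^ S * t) * cinv p β (n + p ^ S * t))
      - curly p α n * curly p β (n + p ^ S * t) * (curly p β n * cinv p β n) := by ring
  rw [this, e1, e2, curly_add, curly_add]
  have : curly p α n * curly p (α + (n : ℤ_[p])) (p ^ S * t) * curly p β n * 1 -
      curly p α n * (curly p β n * curly p (β + (n : ℤ_[p])) (p ^ S * t)) * 1 =
      curly p α n * curly p β n * (curly p (α + (n : ℤ_[p])) (p ^ S * t)
       - curly p (β + (n : ℤ_[p])) (p ^ S * t)) := by ring
  rw [this]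
  exact Dvd.dvd.mul_left h3 _

lemma poch_split {a a' : ℤ_[p]} (h : IsDworkPrime p a a') (n : ℕ) :
    (ascPochhammer ℤ_[p] n).eval a = curly p a n * (p : ℤ_[p]) ^ ((n + p - 1 - dl p a) / p) *
      (ascPochhammer ℤ_[p] ((n + p - 1 - dl p a) / p)).eval a' := by
  have hl := dl_lt a
  have hp : 0 < p := (Fact.out : p.Prime).pos
  induction n with
  | zero =>
    have : (0 + p - 1 - dl p a) / p = 0 := Nat.div_eq_of_lt (by omega)
    rw [this]; simp
  | succ n ih =>
    have e : n + 1 + p - 1 - dl p a = (n + p - 1 - dl p a) + 1 := by omega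
    have e2 : n + p - 1 - dl p a + 1 = n + p - dl p a := by omega
    rw [ascPochhammer_succ_eval, ih, e, Nat.succ_div, curly_succ, e2]
    by_cases hd : (p : ℤ_[p]) ∣ a + (n : ℤ_[p])
    · have hd' := (dvd_add_nat_iff a n).1 hd
      simp only [hd', if_true]
      set m := (n + p - 1 - dl p a) / p with hm
      obtain ⟨t, ht⟩ := hd'
      have ht1 : 1 ≤ t := by
        rcases Nat.eq_zero_or_pos t with h0 | h0
        · subst h0; omega
        · exact h0
      obtain ⟨t', rfl⟩ : ∃ t', t = t' + 1 := ⟨t - 1, by omega⟩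
      have hmt : m = t' := by
        rw [hm]
        have : n + p - 1 - dl p a = p * t' + (p - 1) := by rw [mul_add] at ht; omega
        rw [this, Nat.mul_add_div hp, Nat.div_eq_of_lt (by omega)]; rfl
      have hn : n = dl p a + p * m := by rw [hmt]; rw [mul_add] at ht; omega
      have key : a + (n : ℤ_[p]) = p * (a' + (m : ℤ_[p])) := by
        rw [mul_add, h]
        conv_lhs => rw [hn]
        push_cast; ring
      rw [ascPochhammer_succ_eval, sharp, if_pos hd, key]
      ring
    · have hd' : ¬ p ∣ n + p - dl p a := fun hh => hd ((dvd_add_nat_iff a n).2 hh)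
      simp only [hd', if_false]
      rw [sharp, if_neg hd, add_zero]
      ring

lemma fact_split (n : ℕ) :
    ((n.factorial : ℕ) : ℤ_[p]) = curly p 1 n * (p : ℤ_[p]) ^ (n / p) *
      (((n / p).factorial : ℕ) : ℤ_[p]) := by
  have hp : 1 < p := (Fact.out : p.Prime).one_lt
  have hdl : dl p (1 : ℤ_[p]) = p - 1 := by
    have h1 := dl_lt (p := p) 1
    have h2 := dvd_add_dl (p := p) 1
    have h3 : (p : ℤ_[p]) ∣ ((1 + dl p (1 : ℤ_[p]) : ℕ) : ℤ_[p]) := by push_cast; exact h2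
    rw [pdvd_nat1] at h3
    obtain ⟨t, ht⟩ := h3
    have : t = 1 := by
      rcases Nat.lt_or_ge t 2 with h4 | h4
      · interval_cases t
        · omega
        · rfl
      · have := Nat.mul_le_mul_left p h4
        omega
    subst this
    omega
  have hD : IsDworkPrime p (1 : ℤ_[p]) 1 := by
    unfold IsDworkPrime
    rw [hdl, Nat.cast_sub hp.le]; push_cast; ring
  have := poch_split hD n
  rw [hdl, show n + p - 1 - (p - 1) = n by omega] at this
  have e : ∀ k : ℕ, (ascPochhammer ℤ_[p] k).eval (1 : ℤ_[p]) = (k.factorial : ℤ_[p]) := by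
    intro k
    exact ascPochhammer_eval_one (S := ℤ_[p]) k
  rw [e, e] at this
  exact this

lemma coeff_split_le {a a' : ℤ_[p]} (h : IsDworkPrime p a a') {A A' : ℕ → ℤ_[p]}
    (hA : IsHGCoeff p 2 a A) (hA' : IsHGCoeff p 2 a' A') {x : ℕ} (hx : x ≤ dl p a) (k : ℕ) :
    A (x + p * k) = A' k * (curly p a (x + p * k) * cinv p 1 (x + p * k)) ^ 2 := by
  have hp : 0 < p := (Fact.out : p.Prime).pos
  have hl := dl_lt a
  set n := x + p * k with hn
  have e1 : n / p = k := by
    rw [hn, add_comm, Nat.mul_add_div hp, Nat.div_eq_of_lt (by omega)]; rfl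
  have e2 : (n + p - 1 - dl p a) / p = k := by
    have : n + p - 1 - dl p a = p * k + (x + p - 1 - dl p a) := by omega
    rw [this, Nat.mul_add_div hp, Nat.div_eq_of_lt (by omega)]; rfl
  have h1 := hA n
  rw [poch_split h, fact_split, e1, e2] at h1
  have h2 := hA' k
  have hc := curly_mul_cinv (p := p) 1 n
  have hz : ((p : ℤ_[p]) ^ k * (k.factorial : ℤ_[p]) * curly p 1 n) ^ 2 ≠ 0 := by
    apply pow_ne_zero
    refine mul_ne_zero (mul_ne_zero (pow_ne_zero _ ?_) ?_) (isUnit_curly _ _).ne_zero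
    · exact_mod_cast hp.ne'
    · exact_mod_cast k.factorial_ne_zero
  apply mul_left_cancel₀ hz
  linear_combination h1 - (curly p a n * (p : ℤ_[p]) ^ k) ^ 2 * h2 -
    (p : ℤ_[p]) ^ (2 * k) * (k.factorial : ℤ_[p]) ^ 2 * A' k * curly p a n ^ 2 *
      (curly p 1 n * cinv p 1 n + 1) * hc

lemma coeff_split_gt {a a' : ℤ_[p]} (h : IsDworkPrime p a a') {A A' : ℕ → ℤ_[p]}
    (hA : IsHGCoeff p 2 a A) (hA' : IsHGCoeff p 2 a' A') {x : ℕ} (hx : dl p a < x) (hxp : x < p)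
    (k : ℕ) :
    A (x + p * k) = A' k * ((curly p a (x + p * k) * cinv p 1 (x + p * k)) ^ 2 *
      ((p : ℤ_[p]) * (a' + (k : ℤ_[p]))) ^ 2) := by
  have hp : 0 < p := (Fact.out : p.Prime).pos
  have hl := dl_lt a
  set n := x + p * k with hn
  have e1 : n / p = k := by
    rw [hn, add_comm, Nat.mul_add_div hp, Nat.div_eq_of_lt (by omega)]; rfl
  have e2 : (n + p - 1 - dl p a) / p = k + 1 := by
    have : n + p - 1 - dl p a = p * (k + 1) + (x - 1 - dl p a) := by rw [mul_add]; omega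
    rw [this, Nat.mul_add_div hp, Nat.div_eq_of_lt (by omega)]
  have h1 := hA n
  rw [poch_split h, fact_split, e1, e2, ascPochhammer_succ_eval] at h1
  have h2 := hA' k
  have hc := curly_mul_cinv (p := p) 1 n
  have hz : ((p : ℤ_[p]) ^ k * (k.factorial : ℤ_[p]) * curly p 1 n) ^ 2 ≠ 0 := by
    apply pow_ne_zero
    refine mul_ne_zero (mul_ne_zero (pow_ne_zero _ ?_) ?_) (isUnit_curly _ _).ne_zero
    · exact_mod_cast hp.ne'
    · exact_mod_cast k.factorial_ne_zero
  apply mul_left_cancel₀ hz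
  linear_combination h1 - (curly p a n * (p : ℤ_[p]) ^ (k + 1) * (a' + (k : ℤ_[p]))) ^ 2 * h2 -
    (p : ℤ_[p]) ^ (2 * k + 2) * (a' + (k : ℤ_[p])) ^ 2 * (k.factorial : ℤ_[p]) ^ 2 * A' k *
      curly p a n ^ 2 * (curly p 1 n * cinv p 1 n + 1) * hc

end part1

section part2
set_option linter.unusedSectionVars false
variable {p : ℕ} [Fact p.Prime]

/-- Lipschitz functions with gain `e`. -/
def LipE (p : ℕ) {R : Type*} [CommRing R] (e : ℕ) (q : ℕ → R) : Prop :=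
  ∀ s i t : ℕ, (p : R) ^ (s + e) ∣ q (i + p ^ s * t) - q i

lemma LipE.mul {R : Type*} [CommRing R] {e : ℕ} {f g : ℕ → R} (hf : LipE p e f) (hg : LipE p e g) :
    LipE p e (fun k => f k * g k) := fun s i t => mul_congr (hf s i t) (hg s i t)

lemma LipE.sub {R : Type*} [CommRing R] {e : ℕ} {f g : ℕ → R} (hf : LipE p e f) (hg : LipE p e g) :
    LipE p e (fun k => f k - g k) := fun s i t => by
  have := dvd_sub (hf s i t) (hg s i t)
  convert this using 1
  ring

lemma LipE.map {R S : Type*} [CommRing R] [CommRing S] (ι : R →+* S) {e : ℕ} {f : ℕ → R}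
    (hf : LipE p e f) : LipE p e (fun k => ι (f k)) := fun s i t => by
  have := map_dvd ι (hf s i t)
  simpa using this

lemma hgcoeff_choose (L : ℕ) :
    IsHGCoeff p 2 (-(L : ℤ_[p])) (fun k => ((L.choose k : ℕ) : ℤ_[p]) ^ 2) := by
  intro k
  have h : ∀ k : ℕ, (ascPochhammer ℤ_[p] k).eval (-(L : ℤ_[p])) =
      (-1) ^ k * ((k.factorial * L.choose k : ℕ) : ℤ_[p]) := by
    intro k
    rw [ascPochhammer_eval_neg_eq_descPochhammer, descPochhammer_eval_eq_descFactorial,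
      Nat.descFactorial_eq_factorial_mul_choose]
  rw [h]
  push_cast
  rw [mul_pow, ← pow_mul, mul_comm k 2, pow_mul]
  simp [mul_pow]

lemma dl_neg_nat (L : ℕ) : dl p (-(L : ℤ_[p])) = L % p := by
  have hp : 0 < p := (Fact.out : p.Prime).pos
  have h1 := dl_lt (-(L : ℤ_[p]))
  have h2 := dvd_add_dl (-(L : ℤ_[p]))
  have h3 : (p : ℤ) ∣ (dl p (-(L : ℤ_[p])) : ℤ) - (L : ℤ) := by
    have := PadicInt.pow_p_dvd_int_iff (p := p) 1 ((dl p (-(L : ℤ_[p])) : ℤ) - (L : ℤ))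
    rw [pow_one, pow_one] at this
    apply this.1
    push_cast
    convert h2 using 1
    ring
  have h4 : L ≡ dl p (-(L : ℤ_[p])) [MOD p] := (Nat.modEq_iff_dvd).2 h3
  unfold Nat.ModEq at h4
  rw [h4, Nat.mod_eq_of_lt h1]

lemma dwork_neg_nat (L : ℕ) : IsDworkPrime p (-(L : ℤ_[p])) (-((L / p : ℕ) : ℤ_[p])) := by
  unfold IsDworkPrime
  rw [dl_neg_nat]
  have : ((p * (L / p) + L % p : ℕ) : ℤ_[p]) = (L : ℤ_[p]) := by rw [Nat.div_add_mod]
  push_cast at this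
  linear_combination -this

lemma ratio_lip (α β : ℤ_[p]) (x : ℕ) :
    LipE p 1 (fun k => curly p α (x + p * k) * cinv p β (x + p * k)) := by
  intro s i t
  have := ratio_congr_add (S := s + 1) (by omega) α β (x + p * i) t
  have e : x + p * (i + p ^ s * t) = x + p * i + p ^ (s + 1) * t := by ring
  simp only [e]
  exact this

lemma exists_g (L : ℕ) {x : ℕ} (hx : x < p) : ∃ g : ℕ → ℤ_[p],
    (∀ k, ((L.choose (x + p * k) : ℕ) : ℤ_[p]) ^ 2 = (((L / p).choose k : ℕ) : ℤ_[p]) ^ 2 * g k) ∧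
    LipE p 1 g := by
  rcases Nat.lt_or_ge (dl p (-(L : ℤ_[p]))) x with h | h
  · refine ⟨_, fun k => coeff_split_gt (dwork_neg_nat L) (hgcoeff_choose L)
      (hgcoeff_choose (L / p)) h hx k, ?_⟩
    have h1 := ratio_lip (-(L : ℤ_[p])) 1 x
    have h2 : LipE p 1 (fun k : ℕ => (p : ℤ_[p]) * (-((L / p : ℕ) : ℤ_[p]) + (k : ℤ_[p]))) := by
      intro s i t
      refine ⟨(t : ℤ_[p]), ?_⟩
      push_cast
      ring
    have := (h1.mul h1).mul (h2.mul h2)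
    simpa only [pow_two] using this
  · refine ⟨_, fun k => coeff_split_le (dwork_neg_nat L) (hgcoeff_choose L)
      (hgcoeff_choose (L / p)) h k, ?_⟩
    have h1 := ratio_lip (-(L : ℤ_[p])) 1 x
    have := (h1.mul h1)
    simpa only [pow_two] using this

/-! ### Dwork congruence -/

open PowerSeries

variable {R : Type*} [CommRing R] [IsDomain R]

/-- `Σ binom(L,k)^2 q(k) t^k` -/
noncomputable def Gser (R : Type*) [CommRing R] (L : ℕ) (q : ℕ → R) : PowerSeries R :=
  PowerSeries.mk (fun k => ((L.choose k : ℕ) : R) ^ 2 * q k)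

/-- truncation as power series -/
noncomputable def tr (n : ℕ) (f : PowerSeries R) : PowerSeries R :=
  PowerSeries.mk (fun k => if k < n then coeff k f else 0)

lemma tr_add (n : ℕ) (f g : PowerSeries R) : tr n (f + g) = tr n f + tr n g := by
  ext k; simp [tr]; split_ifs <;> simp

lemma tr_C_mul (n : ℕ) (c : R) (f : PowerSeries R) : tr n (C c * f) = C c * tr n f := by
  ext k; simp [tr]

lemma C_dvd_iff (c : R) (f : PowerSeries R) : C c ∣ f ↔ ∀ k, c ∣ coeff k f := by
  constructor
  · rintro ⟨g, rfl⟩ k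
    simp
  · intro h
    choose g hg using h
    refine ⟨PowerSeries.mk g, ?_⟩
    ext k
    simp [hg]

lemma isUnit_F (L : ℕ) : IsUnit (Gser R L (fun _ => 1)) := by
  rw [PowerSeries.isUnit_iff_constantCoeff, ← PowerSeries.coeff_zero_eq_constantCoeff_apply]
  simp [Gser]

lemma isUnit_trF (L : ℕ) {n : ℕ} (hn : 0 < n) : IsUnit (tr n (Gser R L (fun _ => 1))) := by
  rw [PowerSeries.isUnit_iff_constantCoeff, ← PowerSeries.coeff_zero_eq_constantCoeff_apply]
  simp [Gser, tr, hn]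

lemma coeff_expand' {m : ℕ} (hm : m ≠ 0) (f : PowerSeries R) (k : ℕ) :
    coeff k (PowerSeries.expand m hm f) = if m ∣ k then coeff (k / m) f else 0 := by
  split_ifs with h
  · obtain ⟨t, rfl⟩ := h
    rw [Nat.mul_div_cancel_left _ (Nat.pos_of_ne_zero hm)]
    simp [PowerSeries.coeff_expand_mul]
  · exact PowerSeries.coeff_expand_of_not_dvd m hm f h

lemma split_series {m : ℕ} (hm : m ≠ 0) (f : PowerSeries R) :
    f = ∑ x ∈ Finset.range m, X ^ x *
      PowerSeries.expand m hm (PowerSeries.mk (fun k => coeff (x + m * k) f)) := by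
  ext d
  rw [map_sum]
  have hm' := Nat.pos_of_ne_zero hm
  rw [Finset.sum_eq_single (d % m)]
  · rw [PowerSeries.coeff_X_pow_mul', if_pos (Nat.mod_le d m), coeff_expand', if_pos (Nat.dvd_sub_mod d)]
    rw [coeff_mk]
    have h2 : d % m + m * ((d - d % m) / m) = d := by
      rw [Nat.mul_div_cancel' (Nat.dvd_sub_mod d)]
      have := Nat.mod_le d m
      omega
    rw [h2]
  · intro x hx hne
    rw [PowerSeries.coeff_X_pow_mul']
    split_ifs with h
    · rw [coeff_expand', if_neg]
      intro hd
      apply hne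
      have := (Nat.modEq_iff_dvd' h).2 hd
      unfold Nat.ModEq at this
      rw [Nat.mod_eq_of_lt (Finset.mem_range.1 hx)] at this
      exact this
    · rfl
  · intro h
    exact absurd (Finset.mem_range.2 (Nat.mod_lt d hm')) h

theorem dwork_congr (ι : ℤ_[p] →+* R) (hp0 : (p : R) ≠ 0) (n : ℕ) : ∀ (L : ℕ) (q : ℕ → R),
    LipE p 0 q → C ((p : R) ^ n) ∣ tr (p ^ n) (Gser R L q) * Gser R L (fun _ => 1)
      - Gser R L q * tr (p ^ n) (Gser R L (fun _ => 1)) := by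
  have hp : 0 < p := (Fact.out : p.Prime).pos
  induction n with
  | zero => intro L q _; simp
  | succ n ih =>
    intro L
    set F' := Gser R (L / p) (fun _ => 1) with hF'
    -- first step
    have step : ∀ q : ℕ → R, LipE p 0 q → C ((p : R) ^ (n + 1)) ∣
        tr (p ^ (n + 1)) (Gser R L q) * PowerSeries.expand p hp.ne' F' -
          Gser R L q * PowerSeries.expand p hp.ne' (tr (p ^ n) F') := by
      intro q hq
      have hx : ∀ x, x < p → C ((p : R) ^ (n + 1)) ∣
          tr (p ^ n) (PowerSeries.mk (fun k => coeff (x + p * k) (Gser R L q))) * F' -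
          (PowerSeries.mk (fun k => coeff (x + p * k) (Gser R L q))) * tr (p ^ n) F' := by
        intro x hx
        obtain ⟨g, hg, hgl⟩ := exists_g (p := p) L hx
        set h : ℕ → R := fun k => q (x + p * k) * ι (g k) with hh
        have hhl : LipE p 1 h := by
          have h1 : LipE p 1 (fun k => q (x + p * k)) := by
            intro s i t
            have := hq (s + 1) (x + p * i) t
            have e : x + p * (i + p ^ s * t) = x + p * i + p ^ (s + 1) * t := by ring
            simp only [e]
            exact this
          exact h1.mul (hgl.map ι)
        have hd : ∀ k, ∃ e, h k = h 0 + p * e := by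
          intro k
          obtain ⟨e, he⟩ := hhl 0 0 k
          refine ⟨e, ?_⟩
          simp at he
          linear_combination he
        choose e he using hd
        have hel : LipE p 0 e := by
          intro s i t
          have := hhl s i t
          rw [he, he i, pow_add, pow_one] at this
          rw [add_zero]
          apply (mul_dvd_mul_iff_left hp0).1
          convert this using 1 <;> ring
        have hser : PowerSeries.mk (fun k => coeff (x + p * k) (Gser R L q)) =
            C (h 0) * F' + C (p : R) * Gser R (L / p) e := by
          ext k
          have := congrArg ι (hg k)
          simp only [map_pow, map_natCast, map_mul] at this
          simp only [hF', Gser, coeff_mk, map_add, coeff_C_mul, this]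
          linear_combination ((((L / p).choose k : ℕ) : R) ^ 2) * (he k)
        rw [hser, tr_add, tr_C_mul, tr_C_mul]
        obtain ⟨z, hz⟩ := ih (L / p) e hel
        refine ⟨z, ?_⟩
        have hC : C ((p : R) ^ (n + 1)) = C ((p : R) ^ n) * C (p : R) := by rw [pow_succ, map_mul]
        rw [hC]
        linear_combination C (p : R) * hz
      have e1 := split_series hp.ne' (Gser R L q)
      have e2 : tr (p ^ (n + 1)) (Gser R L q) = ∑ x ∈ Finset.range p, X ^ x *
          PowerSeries.expand p hp.ne'
            (tr (p ^ n) (PowerSeries.mk (fun k => coeff (x + p * k) (Gser R L q)))) := by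
        rw [split_series hp.ne' (tr (p ^ (n + 1)) (Gser R L q))]
        apply Finset.sum_congr rfl
        intro x hx
        congr 2
        ext k
        simp only [tr, coeff_mk]
        have hxp := Finset.mem_range.1 hx
        have : x + p * k < p ^ (n + 1) ↔ k < p ^ n := by
          constructor
          · intro h
            by_contra hk
            push Not at hk
            have := Nat.mul_le_mul_left p hk
            rw [pow_succ, mul_comm (p ^ n)] at h
            omega
          · intro h
            have := Nat.mul_le_mul_left p (Nat.succ_le_of_lt h)
            rw [pow_succ, mul_comm (p ^ n)]
            rw [Nat.succ_eq_add_one, mul_add] at this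
            omega
        simp only [this]
      rw [e2]
      have e3 : Gser R L q * PowerSeries.expand p hp.ne' (tr (p ^ n) F') =
          (∑ x ∈ Finset.range p, X ^ x * PowerSeries.expand p hp.ne'
            (PowerSeries.mk (fun k => coeff (x + p * k) (Gser R L q)))) *
            PowerSeries.expand p hp.ne' (tr (p ^ n) F') := by rw [← e1]
      rw [e3]
      rw [Finset.sum_mul, Finset.sum_mul, ← Finset.sum_sub_distrib]
      apply Finset.dvd_sum
      intro x hxx
      obtain ⟨z, hz⟩ := hx x (Finset.mem_range.1 hxx)
      have hz' := congrArg (PowerSeries.expand p hp.ne') hz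
      rw [map_sub, map_mul, map_mul, map_mul, PowerSeries.expand_C] at hz'
      refine ⟨X ^ x * PowerSeries.expand p hp.ne' z, ?_⟩
      linear_combination X ^ x * hz'
    intro q hq
    have s1 := step q hq
    have s2 := step (fun _ => 1) (fun s i t => by simp)
    have u1 : IsUnit (PowerSeries.expand p hp.ne' F') := (isUnit_F (R := R) (L / p)).map _
    have u2 : IsUnit (PowerSeries.expand p hp.ne' (tr (p ^ n) F')) :=
      (isUnit_trF (R := R) (L / p) (pow_pos hp n)).map _
    set E1 := PowerSeries.expand p hp.ne' F'
    set E2 := PowerSeries.expand p hp.ne' (tr (p ^ n) F')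
    apply unit_cancel (u1.mul u2)
    obtain ⟨z1, hz1⟩ := s1
    obtain ⟨z2, hz2⟩ := s2
    refine ⟨z1 * Gser R L (fun _ => 1) * E2 - z2 * Gser R L q * E2, ?_⟩
    linear_combination Gser R L (fun _ => 1) * E2 * hz1 - Gser R L q * E2 * hz2

end part2

section part3
set_option linter.unusedSectionVars false
variable {p : ℕ} [Fact p.Prime]
variable {R : Type*} [CommRing R] [IsDomain R]
open LaurentPolynomial

/-- reduction to Laurent polynomials -/
noncomputable def lam (I : Ideal R) : Polynomial R →+* LaurentPolynomial (R ⧸ I) :=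
  (Polynomial.toLaurent).comp (Polynomial.mapRingHom (Ideal.Quotient.mk I))

lemma trunc_eq_sum {S : Type*} [CommRing S] (n : ℕ) (f : PowerSeries S) :
    PowerSeries.trunc n f =
      ∑ k ∈ Finset.range n, Polynomial.C (PowerSeries.coeff k f) * Polynomial.X ^ k := by
  ext d
  rw [PowerSeries.coeff_trunc, Polynomial.finsetSum_coeff]
  simp only [Polynomial.coeff_C_mul_X_pow]
  simp

lemma lam_trunc (I : Ideal R) (n : ℕ) (f : PowerSeries R) :
    lam I (PowerSeries.trunc n f) = ∑ k ∈ Finset.range n,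
      C (Ideal.Quotient.mk I (PowerSeries.coeff k f)) * T (k : ℤ) := by
  rw [trunc_eq_sum, map_sum]
  apply Finset.sum_congr rfl
  intro k _
  simp [lam]

lemma lam_trunc_congr (I : Ideal R) (n : ℕ) (f g : PowerSeries R)
    (h : ∀ k < n, PowerSeries.coeff k f - PowerSeries.coeff k g ∈ I) :
    lam I (PowerSeries.trunc n f) = lam I (PowerSeries.trunc n g) := by
  rw [lam_trunc, lam_trunc]
  apply Finset.sum_congr rfl
  intro k hk
  rw [(Ideal.Quotient.eq).2 (h k (Finset.mem_range.1 hk))]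

lemma coe_trunc_eq_tr (n : ℕ) (f : PowerSeries R) :
    ((PowerSeries.trunc n f : Polynomial R) : PowerSeries R) = tr n f := by
  ext k
  simp [tr, PowerSeries.coeff_trunc]

lemma coe_trunc_full (L : ℕ) (q : ℕ → R) :
    ((PowerSeries.trunc (L + 1) (Gser R L q) : Polynomial R) : PowerSeries R) = Gser R L q := by
  ext k
  rw [Polynomial.coeff_coe, PowerSeries.coeff_trunc]
  split_ifs with h
  · rfl
  · simp [Gser, Nat.choose_eq_zero_of_lt (show L < k by omega)]

lemma laurent_dwork (ι : ℤ_[p] →+* R) (hp0 : (p : R) ≠ 0) (n L : ℕ) (q : ℕ → R)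
    (hq : LipE p 0 q) :
    lam (Ideal.span {(p : R) ^ n}) (PowerSeries.trunc (p ^ n) (Gser R L q)) *
      lam (Ideal.span {(p : R) ^ n}) (PowerSeries.trunc (L + 1) (Gser R L (fun _ => 1))) =
    lam (Ideal.span {(p : R) ^ n}) (PowerSeries.trunc (L + 1) (Gser R L q)) *
      lam (Ideal.span {(p : R) ^ n}) (PowerSeries.trunc (p ^ n) (Gser R L (fun _ => 1))) := by
  have h := dwork_congr ι hp0 n L q hq
  rw [← coe_trunc_full L q, ← coe_trunc_full L (fun _ => (1 : R)), ← coe_trunc_eq_tr,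
    ← coe_trunc_eq_tr, ← Polynomial.coe_mul, ← Polynomial.coe_mul, ← Polynomial.coe_sub,
    C_dvd_iff, coe_trunc_full, coe_trunc_full] at h
  rw [← map_mul, ← map_mul, ← sub_eq_zero, ← map_sub]
  unfold lam
  rw [RingHom.comp_apply]
  refine Eq.trans (congrArg _ ?_) (map_zero (Polynomial.toLaurent (R := R ⧸ Ideal.span {(p : R) ^ n})))
  ext k
  rw [Polynomial.coe_mapRingHom, Polynomial.coeff_map, Polynomial.coeff_zero,
    Ideal.Quotient.eq_zero_iff_mem, Ideal.mem_span_singleton]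
  have := h k
  rwa [Polynomial.coeff_coe] at this

lemma invert_lam_full (I : Ideal R) (L : ℕ) (q q' : ℕ → R)
    (h : ∀ k ≤ L, q' k - q (L - k) ∈ I) :
    invert (lam I (PowerSeries.trunc (L + 1) (Gser R L q'))) =
      T (-(L : ℤ)) * lam I (PowerSeries.trunc (L + 1) (Gser R L q)) := by
  rw [lam_trunc, lam_trunc, map_sum, Finset.mul_sum, ← Finset.sum_range_reflect]
  apply Finset.sum_congr rfl
  intro k hk
  have hk' : k ≤ L := by have := Finset.mem_range.1 hk; omega
  have e : L + 1 - 1 - k = L - k := by omega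
  rw [e, map_mul, invert_C, invert_T]
  have hc : Ideal.Quotient.mk I (PowerSeries.coeff (L - k) (Gser R L q')) =
      Ideal.Quotient.mk I (PowerSeries.coeff k (Gser R L q)) := by
    rw [Ideal.Quotient.eq]
    have h1 := h (L - k) (by omega)
    rw [show L - (L - k) = k by omega] at h1
    simp only [Gser, PowerSeries.coeff_mk, Nat.choose_symm hk']
    rw [← mul_sub]
    exact I.mul_mem_left _ h1
  rw [hc]
  have : (T (-((L - k : ℕ) : ℤ)) : LaurentPolynomial (R ⧸ I)) = T (-(L : ℤ)) * T (k : ℤ) := by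
    rw [← T_add, Nat.cast_sub hk']
    congr 1
    ring
  rw [this]
  ring

lemma lam_cancel (I : Ideal R) (L : ℕ) (f : LaurentPolynomial (R ⧸ I))
    (h : f * lam I (PowerSeries.trunc (L + 1) (Gser R L (fun _ => 1))) = 0) : f = 0 := by
  obtain ⟨m, f', hf⟩ := LaurentPolynomial.exists_T_pow f
  have h1 : Polynomial.toLaurent (f' * Polynomial.mapRingHom (Ideal.Quotient.mk I)
      (PowerSeries.trunc (L + 1) (Gser R L (fun _ => 1)))) = 0 := by
    rw [map_mul, hf]
    have : f * T (m : ℤ) * Polynomial.toLaurent (Polynomial.mapRingHom (Ideal.Quotient.mk I)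
      (PowerSeries.trunc (L + 1) (Gser R L (fun _ => 1)))) =
      T (m : ℤ) * (f * lam I (PowerSeries.trunc (L + 1) (Gser R L (fun _ => 1)))) := by
      unfold lam
      rw [RingHom.comp_apply]
      ring
    rw [this, h, mul_zero]
  rw [Polynomial.toLaurent_eq_zero] at h1
  set g := Polynomial.mapRingHom (Ideal.Quotient.mk I)
      (PowerSeries.trunc (L + 1) (Gser R L (fun _ => 1))) with hg
  have hu : IsUnit (g : PowerSeries (R ⧸ I)) := by
    rw [PowerSeries.isUnit_iff_constantCoeff, ← PowerSeries.coeff_zero_eq_constantCoeff_apply,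
      Polynomial.coeff_coe, hg, Polynomial.coe_mapRingHom, Polynomial.coeff_map,
      PowerSeries.coeff_trunc]
    simp [Gser]
  have h2 : (f' : PowerSeries (R ⧸ I)) * (g : PowerSeries (R ⧸ I)) = 0 := by
    rw [← Polynomial.coe_mul, h1, Polynomial.coe_zero]
  have h3 : (f' : PowerSeries (R ⧸ I)) = 0 := (IsUnit.mul_left_eq_zero hu).1 h2
  have h4 : f' = 0 := by
    rwa [Polynomial.coe_eq_zero_iff] at h3
  rw [h4, map_zero] at hf
  have h5 : f * T (m : ℤ) * T (-(m : ℤ)) = 0 := by rw [← hf, zero_mul]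
  rwa [mul_assoc, ← T_add, add_neg_cancel, T_zero, mul_one] at h5

theorem laurent_main (ι : ℤ_[p] →+* R) (hp0 : (p : R) ≠ 0) (n L M : ℕ) (hM : n ≤ M) (q : ℕ → R)
    (hq : LipE p 0 q) :
    lam (Ideal.span {(p : R) ^ n}) (PowerSeries.trunc (p ^ n) (Gser R L q)) *
      invert (lam (Ideal.span {(p : R) ^ n}) (PowerSeries.trunc (p ^ n) (Gser R L (fun _ => 1)))) =
    invert (lam (Ideal.span {(p : R) ^ n}) (PowerSeries.trunc (p ^ n)
        (Gser R L (fun k => q (L + (p ^ M - 1) * k))))) *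
      lam (Ideal.span {(p : R) ^ n}) (PowerSeries.trunc (p ^ n) (Gser R L (fun _ => 1))) := by
  have hp : 0 < p := (Fact.out : p.Prime).pos
  set I := Ideal.span {(p : R) ^ n} with hI
  set q' : ℕ → R := fun k => q (L + (p ^ M - 1) * k) with hq'
  have hq'l : LipE p 0 q' := by
    intro s i t
    have := hq s (L + (p ^ M - 1) * i) ((p ^ M - 1) * t)
    have e : L + (p ^ M - 1) * (i + p ^ s * t) =
      L + (p ^ M - 1) * i + p ^ s * ((p ^ M - 1) * t) := by ring
    simp only [hq', e]
    exact this
  have h1 := laurent_dwork ι hp0 n L q hq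
  have h2 := congrArg invert (laurent_dwork ι hp0 n L q' hq'l)
  rw [map_mul, map_mul] at h2
  rw [← hI] at h1 h2
  have h3 := invert_lam_full I L (fun _ => (1 : R)) (fun _ => (1 : R)) (by intro k _; simp)
  have h4 := invert_lam_full I L q q' (by
    intro k hk
    rw [hI, Ideal.mem_span_singleton]
    have h5 := hq M (L - k) k
    have e : L - k + p ^ M * k = L + (p ^ M - 1) * k := by
      have h6 : 1 ≤ p ^ M := Nat.one_le_pow _ _ hp
      have : p ^ M * k = (p ^ M - 1) * k + k := by
        conv_lhs => rw [← Nat.sub_add_cancel h6]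
        ring
      rw [this]; omega
    rw [e] at h5
    exact (pow_dvd_pow _ (by omega)).trans h5)
  rw [h3, h4] at h2
  rw [← sub_eq_zero]
  apply lam_cancel I L
  apply lam_cancel I L
  have hT : (T (L : ℤ) : LaurentPolynomial (R ⧸ I)) * T (-(L : ℤ)) = 1 := by
    rw [← T_add, add_neg_cancel, T_zero]
  generalize lam I (PowerSeries.trunc (L + 1) (Gser R L (fun _ => 1))) = F at *
  generalize lam I (PowerSeries.trunc (p ^ n) (Gser R L (fun _ => 1))) = F0 at *
  generalize lam I (PowerSeries.trunc (L + 1) (Gser R L q)) = G at *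
  generalize lam I (PowerSeries.trunc (p ^ n) (Gser R L q)) = G0 at *
  generalize lam I (PowerSeries.trunc (p ^ n) (Gser R L q')) = G0' at *
  linear_combination F * (invert F0) * h1 - F * F0 * T (L : ℤ) * h2 +
    (invert G0' * F0 * F * F - F * F0 * G * (invert F0)) * hT

end part3

section part4
set_option linter.unusedSectionVars false
variable {R : Type*} [CommRing R]

/-- iterated differences are highly divisible -/
def Acl (π : R) : ℕ → ℕ → (ℕ → R) → Prop
  | 0, e, f => ∀ n, π ^ e ∣ f n
  | i + 1, e, f => (∀ n, π ^ e ∣ f n) ∧ Acl π i (e + 1) (fun n => f (n + 1) - f n)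

lemma Acl.base {π : R} {i e : ℕ} {f : ℕ → R} (h : Acl π i e f) : ∀ n, π ^ e ∣ f n := by
  cases i with
  | zero => exact h
  | succ i => exact h.1

lemma Acl.down {π : R} {i e : ℕ} {f : ℕ → R} (h : Acl π (i + 1) e f) : Acl π i e f := by
  induction i generalizing e f with
  | zero => exact h.1
  | succ i ih => exact ⟨h.1, ih h.2⟩

lemma Acl.weak {π : R} {i e : ℕ} {f : ℕ → R} (h : Acl π i (e + 1) f) : Acl π i e f := by
  induction i generalizing e f with
  | zero => exact fun n => (pow_dvd_pow π (Nat.le_succ e)).trans (h n)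
  | succ i ih => exact ⟨fun n => (pow_dvd_pow π (Nat.le_succ e)).trans (h.1 n), ih h.2⟩

lemma Acl.shift {π : R} {i e : ℕ} {f : ℕ → R} (h : Acl π i e f) :
    Acl π i e (fun n => f (n + 1)) := by
  induction i generalizing e f with
  | zero => exact fun n => h (n + 1)
  | succ i ih => exact ⟨fun n => h.1 (n + 1), ih h.2⟩

lemma Acl.add {π : R} {i e : ℕ} {f g : ℕ → R} (h : Acl π i e f) (h' : Acl π i e g) :
    Acl π i e (fun n => f n + g n) := by
  induction i generalizing e f g with
  | zero => exact fun n => dvd_add (h n) (h' n)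
  | succ i ih =>
    refine ⟨fun n => dvd_add (h.1 n) (h'.1 n), ?_⟩
    have := ih h.2 h'.2
    convert this using 2
    ring

lemma Acl.const {π : R} {i e : ℕ} {x : R} (h : π ^ e ∣ x) : Acl π i e (fun _ => x) := by
  induction i generalizing e x with
  | zero => exact fun n => h
  | succ i ih =>
    refine ⟨fun n => h, ?_⟩
    simp only [sub_self]
    exact ih (dvd_zero _)

lemma Acl.mul {π : R} {i e e' : ℕ} {f g : ℕ → R} (h : Acl π i e f) (h' : Acl π i e' g) :
    Acl π i (e + e') (fun n => f n * g n) := by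
  induction i generalizing e e' f g with
  | zero => exact fun n => by rw [pow_add]; exact mul_dvd_mul (h n) (h' n)
  | succ i ih =>
    refine ⟨fun n => by rw [pow_add]; exact mul_dvd_mul (h.1 n) (h'.1 n), ?_⟩
    have h1 := ih h.2 h'.down
    have h2 := ih h.shift.down h'.2
    rw [show e + 1 + e' = e + e' + 1 by ring] at h1
    rw [show e + (e' + 1) = e + e' + 1 by ring] at h2
    have := h1.add h2
    convert this using 2
    ring

lemma Acl.neg {π : R} {i e : ℕ} {f : ℕ → R} (h : Acl π i e f) : Acl π i e (fun n => - f n) := by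
  have h1 : Acl π i 0 (fun _ => (-1 : R)) := Acl.const (by simp)
  have := h1.mul h
  rw [zero_add] at this
  convert this using 2
  ring

lemma Acl.sub {π : R} {i e : ℕ} {f g : ℕ → R} (h : Acl π i e f) (h' : Acl π i e g) :
    Acl π i e (fun n => f n - g n) := by
  have := h.add h'.neg
  convert this using 2
  ring

lemma Acl.inv {π : R} {i : ℕ} {f g : ℕ → R} (h : Acl π i 0 f) (hfg : ∀ n, f n * g n = 1) :
    Acl π i 0 g := by
  induction i with
  | zero => exact fun n => by simp
  | succ i ih =>
    refine ⟨fun n => by simp, ?_⟩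
    have h1 := ih h.down
    have h2 := (h.2.mul (h1.mul h1.shift)).neg
    convert h2 using 2 with n
    linear_combination (g n) * hfg (n + 1) - (g (n + 1)) * hfg n

lemma Acl.step {π : R} {f ψ : ℕ → R} (hψ : ∀ i, Acl π i 1 ψ)
    (h : ∀ n, f (n + 1) = f n * (1 + ψ n)) (i : ℕ) : Acl π i 0 f := by
  induction i with
  | zero => exact fun n => by simp
  | succ i ih =>
    refine ⟨fun n => by simp, ?_⟩
    have := ih.mul (hψ i)
    convert this using 2 with n
    rw [h]; ring

lemma Acl.linear {π : R} {i : ℕ} (α : R) : Acl π i 0 (fun k => α + π * (k : R)) := by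
  cases i with
  | zero => exact fun n => by simp
  | succ i =>
    refine ⟨fun n => by simp, ?_⟩
    have : Acl π i (0 + 1) (fun _ => π) := Acl.const (by simp)
    convert this using 2
    push_cast; ring

lemma Acl.map {S : Type*} [CommRing S] (φ : R →+* S) {π : R} {i e : ℕ} {f : ℕ → R}
    (h : Acl π i e f) : Acl (φ π) i e (fun n => φ (f n)) := by
  induction i generalizing e f with
  | zero => exact fun n => by rw [← map_pow]; exact map_dvd φ (h n)
  | succ i ih =>
    refine ⟨fun n => by rw [← map_pow]; exact map_dvd φ (h.1 n), ?_⟩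
    have := ih h.2
    convert this using 2
    rw [map_sub]

lemma Acl.prod {π : R} {i : ℕ} {F : ℕ → ℕ → R} (h : ∀ j, Acl π i 0 (F j)) (m : ℕ) :
    Acl π i 0 (fun k => ∏ j ∈ Finset.range m, F j k) := by
  induction m with
  | zero => simp only [Finset.range_zero, Finset.prod_empty]; exact Acl.const (by simp)
  | succ m ih =>
    simp only [Finset.prod_range_succ]
    exact ih.mul (h m)

lemma Acl.prod_congr {π : R} {i : ℕ} {F G : ℕ → ℕ → R} (h : ∀ j, Acl π i 0 (F j))
    (h' : ∀ j, Acl π i 0 (G j)) (hd : ∀ j, Acl π i 1 (fun k => F j k - G j k)) (m : ℕ) :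
    Acl π i 1 (fun k => ∏ j ∈ Finset.range m, F j k - ∏ j ∈ Finset.range m, G j k) := by
  induction m with
  | zero =>
    simp only [Finset.range_zero, Finset.prod_empty, sub_self]; exact Acl.const (by simp)
  | succ m ih =>
    simp only [Finset.prod_range_succ]
    have h1 := ih.mul (h m)
    have h2 := (Acl.prod h' m).mul (hd m)
    have := h1.add h2
    convert this using 2
    ring

lemma Acl.iter {π : R} {i e : ℕ} {f : ℕ → R} (h : Acl π i e f) (n : ℕ) :
    π ^ (i + e) ∣ (fwdDiff 1)^[i] f n := by
  induction i generalizing e f with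
  | zero => simpa using h n
  | succ i ih =>
    rw [Function.iterate_succ_apply]
    have := ih h.2
    rw [show i + 1 + e = i + (e + 1) by ring]
    exact this

section padic
variable {p : ℕ} [Fact p.Prime]

lemma p_dvd_shift_iff (α x : ℤ_[p]) : (p : ℤ_[p]) ∣ α + p * x ↔ (p : ℤ_[p]) ∣ α :=
  ⟨fun h => (dvd_add_left (Dvd.intro _ rfl)).1 h, fun h => dvd_add h (Dvd.intro _ rfl)⟩

lemma acl_sharp (i : ℕ) (α : ℤ_[p]) : Acl (p : ℤ_[p]) i 0 (fun k => sharp p (α + p * (k : ℤ_[p]))) := by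
  unfold sharp
  simp only [p_dvd_shift_iff]
  by_cases h : (p : ℤ_[p]) ∣ α
  · simp only [h, if_true]; exact Acl.const (by simp)
  · simp only [h, if_false]; exact Acl.linear α

lemma acl_sharp_sub (i : ℕ) (α x : ℤ_[p]) : Acl (p : ℤ_[p]) i 1
    (fun k => sharp p (α + p * x + p * (k : ℤ_[p])) - sharp p (α + p * (k : ℤ_[p]))) := by
  unfold sharp
  simp only [p_dvd_shift_iff]
  by_cases h : (p : ℤ_[p]) ∣ α
  · simp only [h, if_true, sub_self]; exact Acl.const (by simp)
  · simp only [h, if_false]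
    have : Acl (p : ℤ_[p]) i 1 (fun _ => (p : ℤ_[p]) * x) := Acl.const (by simp)
    convert this using 2
    ring

lemma acl_curly (i : ℕ) (α : ℤ_[p]) (m : ℕ) :
    Acl (p : ℤ_[p]) i 0 (fun k => curly p (α + p * (k : ℤ_[p])) m) := by
  simp only [curly_eq]
  have := Acl.prod (fun j => acl_sharp i (α + (j : ℤ_[p]))) m
  convert this using 4
  ring

lemma acl_curly_sub (i : ℕ) (α x : ℤ_[p]) (m : ℕ) : Acl (p : ℤ_[p]) i 1
    (fun k => curly p (α + p * x + p * (k : ℤ_[p])) m - curly p (α + p * (k : ℤ_[p])) m) := by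
  simp only [curly_eq]
  have := Acl.prod_congr (fun j => acl_sharp i (α + (j : ℤ_[p]) + (p : ℤ_[p]) * x))
    (fun j => acl_sharp i (α + (j : ℤ_[p])))
    (fun j => acl_sharp_sub i (α + (j : ℤ_[p])) x) m
  convert this using 5
  · ring
  · ring

lemma acl_curly_succ (i : ℕ) (α : ℤ_[p]) : Acl (p : ℤ_[p]) i 1
    (fun k => curly p (α + 1 + p * (k : ℤ_[p])) p - curly p (α + p * (k : ℤ_[p])) p) := by
  have hS := acl_sharp i α
  choose g hg using fun k : ℕ => (isUnit_sharp (α + (p : ℤ_[p]) * (k : ℤ_[p]))).exists_right_inv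
  have hI := hS.inv (g := g) hg
  have := ((acl_curly i α p).mul (acl_sharp_sub i α 1)).mul hI
  convert this using 2 with k
  have h1 : curly p (α + p * (k : ℤ_[p])) (1 + p) =
      sharp p (α + p * (k : ℤ_[p])) * curly p (α + 1 + p * (k : ℤ_[p])) p := by
    rw [curly_add, show (1 : ℕ) = 0 + 1 from rfl, curly_succ]
    simp only [curly_zero, one_mul, Nat.cast_zero, add_zero, zero_add, Nat.cast_one]
    congr 2; ring
  have h2 : curly p (α + p * (k : ℤ_[p])) (1 + p) = curly p (α + p * (k : ℤ_[p])) p *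
      sharp p (α + p * 1 + p * (k : ℤ_[p])) := by
    rw [add_comm 1 p, curly_succ]
    congr 2; ring
  rw [h1] at h2
  linear_combination (g k) * h2 +
    (curly p (α + p * (k : ℤ_[p])) p - curly p (α + 1 + p * (k : ℤ_[p])) p) * hg k

lemma acl_curly_nat (i : ℕ) (α : ℤ_[p]) (m : ℕ) : Acl (p : ℤ_[p]) i 1
    (fun k => curly p (α + m + p * (k : ℤ_[p])) p - curly p (α + p * (k : ℤ_[p])) p) := by
  induction m with
  | zero =>
    simp only [Nat.cast_zero, add_zero, sub_self]; exact Acl.const (by simp)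
  | succ m ih =>
    have := ih.add (acl_curly_succ i (α + (m : ℤ_[p])))
    convert this using 2
    push_cast
    rw [← add_assoc]
    ring

/-- `{1}_{pk}/{α}_{pk}` squared. -/
noncomputable def rho (p : ℕ) [Fact p.Prime] (a : ℤ_[p]) (k : ℕ) : ℤ_[p] :=
  (curly p 1 k * cinv p a k) ^ 2

lemma rho_mul (a : ℤ_[p]) (k : ℕ) : rho p a k * (curly p a k * cinv p 1 k) ^ 2 = 1 := by
  unfold rho
  have h1 := curly_mul_cinv (1 : ℤ_[p]) k
  have h2 := curly_mul_cinv a k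
  rw [← mul_pow]
  have : curly p 1 k * cinv p a k * (curly p a k * cinv p 1 k) = 1 := by
    calc _ = (curly p 1 k * cinv p 1 k) * (curly p a k * cinv p a k) := by ring
      _ = 1 := by rw [h1, h2, one_mul]
  rw [this, one_pow]

lemma acl_rho {a : ℤ_[p]} : ∃ ψ : ℕ → ℤ_[p], (∀ i, Acl (p : ℤ_[p]) i 1 ψ) ∧
    ∀ k, rho p a (p * (k + 1)) = rho p a (p * k) * (1 + ψ k) := by
  have hd := dvd_add_dl a
  obtain ⟨x, hx⟩ := hd
  have hNM : ∀ i, Acl (p : ℤ_[p]) i 1 (fun k => curly p (1 + p * (k : ℤ_[p])) p -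
      curly p (a + p * (k : ℤ_[p])) p) := by
    intro i
    have h1 := acl_curly_nat i a (dl p a)
    have h2 := acl_curly_sub i 0 x p
    have h3 := acl_curly_succ i (0 : ℤ_[p])
    have := (h3.sub h2).add h1
    convert this using 2
    rw [hx, zero_add, zero_add]
    ring
  set g : ℕ → ℤ_[p] := fun k => cinv p (a + p * (k : ℤ_[p])) p with hg
  have hI : ∀ i, Acl (p : ℤ_[p]) i 0 g := fun i =>
    (acl_curly i a p).inv (fun n => curly_mul_cinv _ _)
  refine ⟨fun k => (curly p (1 + p * (k : ℤ_[p])) p -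
      curly p (a + p * (k : ℤ_[p])) p) * (curly p (1 + p * (k : ℤ_[p])) p +
      curly p (a + p * (k : ℤ_[p])) p) * (g k * g k), ?_, ?_⟩
  · intro i
    exact ((hNM i).mul ((acl_curly i 1 p).add (acl_curly i a p))).mul ((hI i).mul (hI i))
  · intro k
    have h1 : curly p 1 (p * (k + 1)) = curly p 1 (p * k) * curly p (1 + p * (k : ℤ_[p])) p := by
      rw [mul_add, mul_one, curly_add]; push_cast; rfl
    have h2 : curly p a (p * (k + 1)) = curly p a (p * k) * curly p (a + p * (k : ℤ_[p])) p := by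
      rw [mul_add, mul_one, curly_add]; push_cast; rfl
    have e1 := curly_mul_cinv a (p * (k + 1))
    have e2 := curly_mul_cinv a (p * k)
    have e3 : curly p (a + p * (k : ℤ_[p])) p * g k = 1 := curly_mul_cinv _ _
    have h3 : cinv p a (p * (k + 1)) = cinv p a (p * k) * g k := by
      apply (isUnit_curly a (p * (k + 1))).mul_left_cancel
      rw [e1, h2]
      calc (1 : ℤ_[p]) = (curly p a (p * k) * cinv p a (p * k)) *
            (curly p (a + p * (k : ℤ_[p])) p * g k) := by rw [e2, e3, one_mul]
        _ = _ := by ring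
    unfold rho
    rw [h1, h3]
    set C := curly p (a + p * (k : ℤ_[p])) p
    linear_combination (curly p 1 (p * k) * cinv p a (p * k)) ^ 2 * (C * g k + 1) * e3

end padic
end part4

section part5
set_option linter.unusedSectionVars false
variable {p : ℕ} [Fact p.Prime]

lemma exists_v (hp3 : 3 ≤ p) : ∃ v : ℕ → ℤ_[p], (∀ j, (((j + 1).factorial : ℕ) : ℤ_[p]) * v j =
    (p : ℤ_[p]) ^ j) ∧ ∀ j, 1 ≤ j → (p : ℤ_[p]) ∣ v j := by
  have key : ∀ j, ∃ x : ℤ_[p], (((j + 1).factorial : ℕ) : ℤ_[p]) * x = (p : ℤ_[p]) ^ j ∧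
      (1 ≤ j → (p : ℤ_[p]) ∣ x) := by
    intro j
    have h1 := sub_one_mul_padicValNat_factorial_lt_of_ne_zero (p := p) (n := j + 1) (by omega)
    set V := padicValNat p (j + 1).factorial with hV
    have h2 : 2 * V ≤ (p - 1) * V := Nat.mul_le_mul_right _ (by omega)
    obtain ⟨y, hy⟩ := (pow_padicValNat_dvd : p ^ padicValNat p (j + 1).factorial ∣ _)
    have hy' : ¬ p ∣ y := by
      rintro ⟨z, rfl⟩
      have : p ^ (padicValNat p (j + 1).factorial + 1) ∣ (j + 1).factorial :=
        ⟨z, by rw [pow_succ, mul_assoc]; exact hy⟩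
      exact pow_succ_padicValNat_not_dvd (Nat.factorial_ne_zero _) this
    rw [← pdvd_nat1 (p := p)] at hy'
    obtain ⟨b, hb⟩ := (isUnit_of_not_dvd hy').exists_right_inv
    refine ⟨b * (p : ℤ_[p]) ^ (j - V), ?_, ?_⟩
    · rw [hy, ← hV]
      push_cast
      calc _ = ((y : ℤ_[p]) * b) * ((p : ℤ_[p]) ^ V * (p : ℤ_[p]) ^ (j - V)) := by ring
        _ = _ := by rw [hb, one_mul, ← pow_add]; congr 1; omega
    · intro hj
      exact Dvd.dvd.mul_left (dvd_pow_self _ (by omega)) _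
  choose v hv using key
  exact ⟨v, fun j => (hv j).1, fun j => (hv j).2⟩

variable {R : Type*} [CommRing R]

lemma desc_congr (d : R) (x y : R) (h : d ∣ x - y) (j : ℕ) :
    d ∣ (descPochhammer R j).eval x - (descPochhammer R j).eval y :=
  h.trans (Polynomial.sub_dvd_eval_sub _ _ _)

lemma choose_fact (ι : ℤ_[p] →+* R) {v : ℕ → ℤ_[p]}
    (hv : ∀ j, (((j + 1).factorial : ℕ) : ℤ_[p]) * v j = (p : ℤ_[p]) ^ j) (k j : ℕ) :
    (((k + 1).choose (j + 1) : ℕ) : R) * (p : R) ^ (j + 1) =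
      (p : R) * ((k + 1 : ℕ) : R) * ((k.descFactorial j : ℕ) : R) * ι (v j) := by
  have h1 := congrArg ι (hv j)
  rw [map_mul, map_natCast, map_pow, map_natCast] at h1
  have h2 : (k + 1) * k.descFactorial j = (j + 1).factorial * (k + 1).choose (j + 1) := by
    rw [← Nat.succ_descFactorial_succ, Nat.descFactorial_eq_factorial_mul_choose]
  have h3 := congrArg (Nat.cast : ℕ → R) h2
  push_cast at h3 h1 ⊢
  rw [pow_succ, ← h1]
  linear_combination (-(p : R)) * ι (v j) * h3

/-- the quotient built from Newton's expansion -/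
noncomputable def newtonQ (ι : ℤ_[p] →+* R) (v : ℕ → ℤ_[p]) (α : ℕ → R) (k : ℕ) : R :=
  ∑ j ∈ Finset.range (k + 1), ((k.descFactorial j : ℕ) : R) * ι (v j) * α (j + 1)

lemma newtonQ_ext (ι : ℤ_[p] →+* R) (v : ℕ → ℤ_[p]) (α : ℕ → R) (k K : ℕ) (hK : k < K) :
    newtonQ ι v α k =
      ∑ j ∈ Finset.range K, ((k.descFactorial j : ℕ) : R) * ι (v j) * α (j + 1) := by
  unfold newtonQ
  apply Finset.sum_subset
  · intro x hx
    simp only [Finset.mem_range] at *; omega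
  · intro x _ hx
    simp only [Finset.mem_range] at *
    rw [Nat.descFactorial_eq_zero_iff_lt.2 (by omega)]
    simp

lemma newtonQ_eq (ι : ℤ_[p] →+* R) {v : ℕ → ℤ_[p]}
    (hv : ∀ j, (((j + 1).factorial : ℕ) : ℤ_[p]) * v j = (p : ℤ_[p]) ^ j) (α : ℕ → R) (k : ℕ) :
    ∑ i ∈ Finset.range (k + 1 + 1), (((k + 1).choose i : ℕ) : R) * ((p : R) ^ i * α i) =
      α 0 + (p : R) * ((k + 1 : ℕ) : R) * newtonQ ι v α k := by
  rw [Finset.sum_range_succ']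
  simp only [Nat.choose_zero_right, Nat.cast_one, pow_zero, one_mul]
  rw [add_comm]
  congr 1
  unfold newtonQ
  rw [Finset.mul_sum]
  apply Finset.sum_congr rfl
  intro j _
  have := choose_fact ι hv k j
  linear_combination (α (j + 1)) * this

lemma newtonQ_lip (ι : ℤ_[p] →+* R) {v : ℕ → ℤ_[p]}
    (hv : ∀ j, 1 ≤ j → (p : ℤ_[p]) ∣ v j) (α : ℕ → R) (s k t : ℕ) :
    (p : R) ^ (s + 1) ∣ newtonQ ι v α (k + p ^ s * t) - newtonQ ι v α k := by
  rw [newtonQ_ext ι v α k (k + p ^ s * t + 1) (by have := Nat.zero_le (p ^ s * t); omega)]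
  unfold newtonQ
  rw [← Finset.sum_sub_distrib]
  apply Finset.dvd_sum
  intro j _
  rcases Nat.eq_zero_or_pos j with rfl | hj
  · simp
  · have h1 : (p : R) ∣ ι (v j) := by
      have := map_dvd ι (hv j hj)
      rwa [map_natCast] at this
    have h2 : (p : R) ^ s ∣ (((k + p ^ s * t).descFactorial j : ℕ) : R) -
        ((k.descFactorial j : ℕ) : R) := by
      rw [← descPochhammer_eval_eq_descFactorial, ← descPochhammer_eval_eq_descFactorial]
      apply desc_congr
      push_cast
      exact ⟨(t : R), by ring⟩
    have h3 := mul_dvd_mul h2 h1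
    rw [← pow_succ] at h3
    have h4 := Dvd.dvd.mul_right h3 (α (j + 1))
    convert h4 using 1
    ring

lemma newton_exists (ι : ℤ_[p] →+* R) {v : ℕ → ℤ_[p]}
    (hv : ∀ j, (((j + 1).factorial : ℕ) : ℤ_[p]) * v j = (p : ℤ_[p]) ^ j)
    {f : ℕ → R} (hf : ∀ i, Acl (p : R) i 0 f) : ∃ α : ℕ → R, ∀ k,
      f (k + 1) = f 0 + (p : R) * ((k + 1 : ℕ) : R) * newtonQ ι v α k := by
  have h : ∀ i, ∃ x, (fwdDiff 1)^[i] f 0 = (p : R) ^ i * x ∧ (i = 0 → x = f 0) := by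
    intro i
    rcases Nat.eq_zero_or_pos i with rfl | hi
    · exact ⟨f 0, by simp⟩
    · obtain ⟨x, hx⟩ := (hf i).iter 0
      exact ⟨x, by simpa using hx, by omega⟩
  choose α hα using h
  refine ⟨α, fun k => ?_⟩
  have h1 := shift_eq_sum_fwdDiff_iter 1 f (k + 1) 0
  rw [← (hα 0).2 rfl, ← newtonQ_eq ι hv α k]
  simp only [smul_eq_mul, mul_one, zero_add] at h1
  rw [h1]
  apply Finset.sum_congr rfl
  intro i _
  rw [(hα i).1, nsmul_eq_mul]

/-- expansion of `c^{p^S}` -/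
lemma cpow_expand [IsDomain R] (ι : ℤ_[p] →+* R) (hp0 : ∀ k : ℕ, k ≠ 0 → (k : R) ≠ 0)
    {v : ℕ → ℤ_[p]}
    (hv : ∀ j, (((j + 1).factorial : ℕ) : ℤ_[p]) * v j = (p : ℤ_[p]) ^ j)
    (w : ℕ → ℤ_[p]) (hw : ∀ i : ℕ, 1 ≤ i → ((i : ℤ_[p]) * (p : ℤ_[p])) * w i = (p : ℤ_[p]) ^ i)
    (u : R) (S : ℕ) : ∃ E : R, (1 + (p : R) * u) ^ (p ^ S) = 1 + (p : R) ^ (S + 1) * E ∧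
      (p : R) ^ S ∣ E - ∑ i ∈ Finset.Icc 1 (p ^ S), (-1 : R) ^ (i + 1) * ι (w i) * u ^ i := by
  have hp : 0 < p := (Fact.out : p.Prime).pos
  obtain ⟨k, hk⟩ : ∃ k, p ^ S = k + 1 := ⟨p ^ S - 1, by have := pow_pos hp S; omega⟩
  have hkR : (k : R) + 1 = (p : R) ^ S := by
    have := congrArg (Nat.cast : ℕ → R) hk
    push_cast at this; exact this.symm
  refine ⟨newtonQ ι v (fun i => u ^ i) k, ?_, ?_⟩
  · have := newtonQ_eq ι hv (fun i => u ^ i) k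
    rw [hk, add_comm 1, add_pow]
    have e : (p : R) ^ (S + 1) = p * ((k + 1 : ℕ) : R) := by
      push_cast; rw [hkR]; ring
    rw [e]
    rw [pow_zero] at this
    rw [← this]
    apply Finset.sum_congr rfl
    intro i _
    rw [mul_pow]; simp; ring
  · have hvw : ∀ j, (((j.factorial : ℕ)) : R) * ι (v j) = ι (w (j + 1)) := by
      intro j
      have h1 := congrArg ι (hv j)
      have h2 := congrArg ι (hw (j + 1) (by omega))
      simp only [map_mul, map_pow, map_natCast] at h1 h2
      have h3 : (((j + 1 : ℕ)) : R) * (p : R) ≠ 0 :=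
        mul_ne_zero (hp0 _ (by omega)) (hp0 _ (by omega))
      apply mul_left_cancel₀ h3
      rw [h2, pow_succ, ← h1, Nat.factorial_succ]
      push_cast; ring
    have e2 : ∑ i ∈ Finset.Icc 1 (p ^ S), (-1 : R) ^ (i + 1) * ι (w i) * u ^ i =
        ∑ j ∈ Finset.range (k + 1), (-1 : R) ^ j * ι (w (j + 1)) * u ^ (j + 1) := by
      rw [hk]
      symm
      apply Finset.sum_bij (fun j _ => j + 1)
      · intro j hj; simp only [Finset.mem_range, Finset.mem_Icc] at *; omega
      · intro a _ b _ h; omega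
      · intro b hb
        simp only [Finset.mem_Icc] at hb
        exact ⟨b - 1, by simp only [Finset.mem_range]; omega, by omega⟩
      · intro j _
        rw [pow_add (-1 : R) (j + 1) 1, pow_succ]; ring
    rw [e2]
    unfold newtonQ
    rw [← Finset.sum_sub_distrib]
    apply Finset.dvd_sum
    intro j _
    have h2 : (p : R) ^ S ∣ ((k.descFactorial j : ℕ) : R) - (-1) ^ j * ((j.factorial : ℕ) : R) := by
      have e3 : ∀ j : ℕ, (descPochhammer R j).eval (-1) = (-1) ^ j * ((j.factorial : ℕ) : R) := by
        intro j
        induction j with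
        | zero => simp
        | succ j ih =>
          rw [descPochhammer_succ_eval, ih, Nat.factorial_succ]; push_cast; ring
      rw [← e3, ← descPochhammer_eval_eq_descFactorial]
      apply desc_congr
      rw [← hkR]; exact ⟨1, by ring⟩
    rw [← hvw]
    have h4 := Dvd.dvd.mul_right h2 (ι (v j) * u ^ (j + 1))
    convert h4 using 1
    ring

end part5

section part6
set_option linter.unusedSectionVars false
variable {p : ℕ} [Fact p.Prime]

/-- harmonic sum over indices prime to `p` -/
noncomputable def Hs (p : ℕ) [Fact p.Prime] (m : ℕ) : ℤ_[p] :=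
  ∑ j ∈ Finset.range m, Ring.inverse (1 + (j : ℤ_[p]))

lemma not_isUnit_of_dvd {x : ℤ_[p]} (h : (p : ℤ_[p]) ∣ x) : ¬ IsUnit x := by
  intro hx
  exact PadicInt.prime_p.not_isUnit (isUnit_of_dvd_unit h hx)

lemma curly_shift_sq {S : ℕ} (hS : 1 ≤ S) (m : ℕ) : ((p : ℤ_[p]) ^ S) ^ 2 ∣
    curly p (1 + (p : ℤ_[p]) ^ S) m - curly p 1 m * (1 + (p : ℤ_[p]) ^ S * Hs p m) := by
  induction m with
  | zero => simp [Hs]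
  | succ m ih =>
    have hH : Hs p (m + 1) = Hs p m + Ring.inverse (1 + (m : ℤ_[p])) := Finset.sum_range_succ _ _
    rw [curly_succ, curly_succ, hH]
    have e : sharp p (1 + (p : ℤ_[p]) ^ S + m) =
        sharp p (1 + (m : ℤ_[p])) * (1 + (p : ℤ_[p]) ^ S * Ring.inverse (1 + (m : ℤ_[p]))) := by
      have h1 : (p : ℤ_[p]) ∣ 1 + (p : ℤ_[p]) ^ S + m ↔ (p : ℤ_[p]) ∣ 1 + (m : ℤ_[p]) := by
        have := p_dvd_shift_iff (1 + (m : ℤ_[p])) ((p : ℤ_[p]) ^ (S - 1))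
        rw [← pow_succ', Nat.sub_add_cancel hS] at this
        rw [← this]
        ring_nf
      unfold sharp
      by_cases h : (p : ℤ_[p]) ∣ 1 + (m : ℤ_[p])
      · rw [if_pos (h1.2 h), if_pos h, Ring.inverse_non_unit _ (not_isUnit_of_dvd h)]; simp
      · rw [if_neg (fun h' => h (h1.1 h')), if_neg h]
        have := Ring.mul_inverse_cancel _ (isUnit_of_not_dvd h)
        linear_combination (-(p : ℤ_[p]) ^ S) * this
    rw [e]
    obtain ⟨z, hz⟩ := ih
    refine ⟨z * (sharp p (1 + (m : ℤ_[p])) * (1 + (p : ℤ_[p]) ^ S * Ring.inverse (1 + (m : ℤ_[p])))) +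
      curly p 1 m * Hs p m * Ring.inverse (1 + (m : ℤ_[p])) * sharp p (1 + (m : ℤ_[p])), ?_⟩
    linear_combination (sharp p (1 + (m : ℤ_[p])) *
      (1 + (p : ℤ_[p]) ^ S * Ring.inverse (1 + (m : ℤ_[p])))) * hz

lemma rho_expand (a : ℤ_[p]) {S : ℕ} (hS : 1 ≤ S) :
    ∃ X : ℤ_[p], rho p a (p ^ S) = 1 - (p : ℤ_[p]) ^ S * X ∧
      (p : ℤ_[p]) ^ S ∣ X - 2 * Hs p ((a - 1).appr (2 * S)) := by
  set m := (a - 1).appr (2 * S) with hm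
  set P := (p : ℤ_[p]) ^ S with hP
  have hPP : P ^ 2 = (p : ℤ_[p]) ^ (2 * S) := by rw [hP, ← pow_mul]; ring_nf
  have h1 : P ^ 2 ∣ curly p a (p ^ S) - curly p (1 + m) (p ^ S) := by
    rw [hPP]
    apply curly_congr (by omega)
    have := PadicInt.appr_spec (2 * S) (a - 1)
    rw [Ideal.mem_span_singleton] at this
    convert this using 1
    ring
  have h2 : curly p 1 m * curly p (1 + (m : ℤ_[p])) (p ^ S) =
      curly p 1 (p ^ S) * curly p (1 + P) m := by
    rw [← curly_add, add_comm m, curly_add]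
    push_cast; rfl
  have h3 := curly_shift_sq (p := p) hS m
  rw [← hP] at h3
  have h4 : P ^ 2 ∣ curly p a (p ^ S) - curly p 1 (p ^ S) * (1 + P * Hs p m) := by
    refine congr_trans h1 ?_
    apply unit_cancel (isUnit_curly 1 m)
    have h5 := Dvd.dvd.mul_left h3 (curly p 1 (p ^ S))
    convert h5 using 1
    linear_combination h2
  obtain ⟨z, hz⟩ := h4
  -- rho * (curly a)^2 = (curly 1)^2
  have hr : rho p a (p ^ S) * curly p a (p ^ S) ^ 2 = curly p 1 (p ^ S) ^ 2 := by
    unfold rho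
    have := curly_mul_cinv a (p ^ S)
    linear_combination (curly p 1 (p ^ S)) ^ 2 *
      (curly p a (p ^ S) * cinv p a (p ^ S) + 1) * this
  have hd : P ∣ curly p a (p ^ S) ^ 2 - curly p 1 (p ^ S) ^ 2 := by
    refine ⟨(P * z + curly p 1 (p ^ S) * Hs p m) * (curly p a (p ^ S) + curly p 1 (p ^ S)), ?_⟩
    linear_combination (curly p a (p ^ S) + curly p 1 (p ^ S)) * hz
  have hX : ∃ X, rho p a (p ^ S) = 1 - P * X := by
    have : P ∣ 1 - rho p a (p ^ S) := by
      apply unit_cancel ((isUnit_curly a (p ^ S)).pow 2)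
      rw [hr, one_mul]; exact hd
    obtain ⟨X, hX⟩ := this
    exact ⟨X, by rw [← hX]; ring⟩
  obtain ⟨X, hX⟩ := hX
  refine ⟨X, hX, ?_⟩
  have hP0 : P ≠ 0 := pow_ne_zero _ PadicInt.prime_p.ne_zero
  rw [← (isUnit_curly (1 : ℤ_[p]) (p ^ S) |>.pow 2).dvd_mul_right]
  rw [← mul_dvd_mul_iff_left hP0]
  rw [hX] at hr
  have hca : curly p a (p ^ S) = curly p 1 (p ^ S) * (1 + P * Hs p m) + P ^ 2 * z := by
    linear_combination hz
  rw [hca] at hr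
  set C := curly p 1 (p ^ S)
  set H := Hs p m
  refine ⟨(1 - P * X) * (P * (P * z) ^ 2 * 0 + P ^ 2 * z ^ 2 + 2 * C * (1 + P * H) * z) +
    C ^ 2 * H ^ 2 - X * C ^ 2 * (2 * H + P * H ^ 2), ?_⟩
  linear_combination -hr

lemma D_eq {D : ℤ_[p] → ℚ_[p]} (hDval : ∀ m : ℕ, D (1 + (m : ℤ_[p])) =
      ∑ j ∈ (Finset.Icc 1 m).filter (fun j => ¬ (p ∣ j)), ((j : ℚ_[p]))⁻¹) (m : ℕ) :
    D (1 + (m : ℤ_[p])) = ((Hs p m : ℤ_[p]) : ℚ_[p]) := by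
  rw [hDval]
  induction m with
  | zero => simp [Hs]
  | succ m ih =>
    have hH : Hs p (m + 1) = Hs p m + Ring.inverse (1 + (m : ℤ_[p])) := Finset.sum_range_succ _ _
    have e1 : (m : ℤ_[p]) + 1 = ((m + 1 : ℕ) : ℤ_[p]) := by push_cast; rfl
    rw [hH, ← Finset.insert_Icc_right_eq_Icc_add_one (by omega), Finset.filter_insert, PadicInt.coe_add, ← ih,
      add_comm 1, e1]
    split_ifs with h
    · rw [← pdvd_nat1 (p := p)] at h
      rw [Ring.inverse_non_unit _ (not_isUnit_of_dvd h)]; simp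
    · rw [← pdvd_nat1 (p := p)] at h
      rw [Finset.sum_insert (by simp), add_comm]
      congr 1
      have h2 := congrArg (fun x : ℤ_[p] => (x : ℚ_[p])) (Ring.mul_inverse_cancel _ (isUnit_of_not_dvd h))
      simp only [PadicInt.coe_mul, PadicInt.coe_one, PadicInt.coe_natCast] at h2
      exact inv_eq_of_mul_eq_one_right h2

lemma D_lim {D : ℤ_[p] → ℚ_[p]} (hDcont : Continuous D)
    (hDval : ∀ m : ℕ, D (1 + (m : ℤ_[p])) =
      ∑ j ∈ (Finset.Icc 1 m).filter (fun j => ¬ (p ∣ j)), ((j : ℚ_[p]))⁻¹)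
    {a Da : ℤ_[p]} (hDa : (Da : ℚ_[p]) = D a) (m : ℕ) :
    ∃ S₀, ∀ S ≥ S₀, (p : ℤ_[p]) ^ m ∣ Da - Hs p ((a - 1).appr (2 * S)) := by
  have hp : 1 < (p : ℝ) := by exact_mod_cast (Fact.out : p.Prime).one_lt
  have hε : (0 : ℝ) < (p : ℝ) ^ (-(m : ℤ)) := by positivity
  obtain ⟨δ, hδ, hD⟩ := Metric.continuous_iff.1 hDcont a _ hε
  obtain ⟨S₀, hS₀⟩ := exists_pow_lt_of_lt_one hδ (show ((p : ℝ)⁻¹) < 1 from inv_lt_one_of_one_lt₀ hp)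
  refine ⟨S₀, fun S hS => ?_⟩
  have h1 := PadicInt.appr_spec (2 * S) (a - 1)
  rw [← PadicInt.norm_le_pow_iff_mem_span_pow] at h1
  have h2 := hD (1 + ((a - 1).appr (2 * S) : ℤ_[p])) (by
    rw [dist_comm, dist_eq_norm]
    rw [show a - (1 + ((a - 1).appr (2 * S) : ℤ_[p])) = a - 1 - ((a - 1).appr (2 * S) : ℤ_[p]) by ring]
    refine h1.trans_lt (lt_of_le_of_lt ?_ hS₀)
    rw [zpow_neg, zpow_natCast, ← inv_pow]
    exact pow_le_pow_of_le_one (by positivity) (inv_le_one_of_one_le₀ hp.le) (by omega))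
  rw [D_eq hDval, ← hDa, dist_comm, dist_eq_norm, ← PadicInt.coe_sub, ← PadicInt.norm_def] at h2
  have := (PadicInt.norm_le_pow_iff_mem_span_pow _ _).1 h2.le
  rwa [Ideal.mem_span_singleton] at this

end part6

section part7
set_option linter.unusedSectionVars false
variable {p : ℕ} [Fact p.Prime]
variable {R : Type*} [CommRing R]

lemma acl_f (ι : ℤ_[p] →+* R) (a : ℤ_[p]) (u : R) (i : ℕ) :
    Acl (p : R) i 0 (fun k => (1 + (p : R) * u) ^ k * ι (rho p a (p * k))) := by
  obtain ⟨ψ, hψ, hr⟩ := acl_rho (a := a)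
  refine Acl.step (ψ := fun k => (1 + (p : R) * u) * ι (ψ k) + p * u) ?_ ?_ i
  · intro i
    have h1 : Acl (p : R) i 0 (fun _ => 1 + (p : R) * u) := Acl.const (by simp)
    have h2 := (hψ i).map ι
    rw [map_natCast] at h2
    have h3 : Acl (p : R) i 1 (fun _ => (p : R) * u) := Acl.const (by simp)
    have := h1.mul h2
    rw [zero_add] at this
    exact this.add h3
  · intro k
    simp only [hr, map_mul, map_add, map_one]
    ring

lemma rho_zero (a : ℤ_[p]) : rho p a 0 = 1 := by
  have := curly_mul_cinv a 0
  simp only [curly_zero, one_mul] at this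
  simp [rho, this]

variable [IsDomain R]

lemma qm_limit (ι : ℤ_[p] →+* R) (hp0 : ∀ k : ℕ, k ≠ 0 → (k : R) ≠ 0)
    {v : ℕ → ℤ_[p]}
    (hv : ∀ j, (((j + 1).factorial : ℕ) : ℤ_[p]) * v j = (p : ℤ_[p]) ^ j)
    {a : ℤ_[p]} {u : R} {α : ℕ → R}
    (hα : ∀ k, (1 + (p : R) * u) ^ (k + 1) * ι (rho p a (p * (k + 1))) =
      1 + (p : R) * ((k + 1 : ℕ) : R) * newtonQ ι v α k)
    {D : ℤ_[p] → ℚ_[p]} (hDcont : Continuous D)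
    (hDval : ∀ m : ℕ, D (1 + (m : ℤ_[p])) =
      ∑ j ∈ (Finset.Icc 1 m).filter (fun j => ¬ (p ∣ j)), ((j : ℚ_[p]))⁻¹)
    {Da : ℤ_[p]} (hDa : (Da : ℚ_[p]) = D a)
    {w : ℕ → ℤ_[p]} (hw : ∀ i : ℕ, 1 ≤ i → ((i : ℤ_[p]) * (p : ℤ_[p])) * w i = (p : ℤ_[p]) ^ i)
    {Lg : R}
    (hLg : ∀ m : ℕ, ∃ M : ℕ, ∀ n ≥ M, Lg - ∑ i ∈ Finset.Icc 1 n, (-1 : R) ^ (i + 1) * ι (w i) * u ^ i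
      ∈ Ideal.span {(p : R) ^ m}) (m : ℕ) :
    ∃ S, m ≤ S ∧ (p : R) ^ m ∣ (2 * ι Da - Lg) + newtonQ ι v α (p ^ S - 1) := by
  have hp : 1 < p := (Fact.out : p.Prime).one_lt
  obtain ⟨M, hM⟩ := hLg m
  obtain ⟨S₀, hS₀⟩ := D_lim hDcont hDval hDa m
  set S := m + M + S₀ with hS
  refine ⟨S, by omega, ?_⟩
  obtain ⟨E, hE1, hE2⟩ := cpow_expand ι hp0 hv w hw u S
  obtain ⟨X, hX1, hX2⟩ := rho_expand a (show 1 ≤ S + 1 by omega)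
  have h1 := hM (p ^ S) (by have := Nat.lt_pow_self hp (n := S); omega)
  rw [Ideal.mem_span_singleton] at h1
  have h2 := hS₀ (S + 1) (by omega)
  have h3 := map_dvd ι h2
  have h4 := map_dvd ι hX2
  simp only [map_pow, map_natCast, map_sub, map_mul, map_ofNat] at h3 h4
  have h5 := hα (p ^ S - 1)
  have hpS : 1 ≤ p ^ S := Nat.one_le_pow _ _ (by omega)
  rw [Nat.sub_add_cancel hpS, hE1, ← pow_succ', hX1] at h5
  simp only [map_sub, map_mul, map_pow, map_natCast, map_one, Nat.cast_pow] at h5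
  rw [← pow_succ'] at h5
  set Nq := newtonQ ι v α (p ^ S - 1)
  have hP0 : (p : R) ^ (S + 1) ≠ 0 := pow_ne_zero _ (hp0 _ (by omega))
  have h6 : Nq = E - ι X - (p : R) ^ (S + 1) * (E * ι X) := by
    apply mul_left_cancel₀ hP0
    linear_combination -h5
  have d1 : (p : R) ^ m ∣ (p : R) ^ S := pow_dvd_pow _ (by omega)
  have d2 : (p : R) ^ m ∣ (p : R) ^ (S + 1) := pow_dvd_pow _ (by omega)
  set Sg := ∑ i ∈ Finset.Icc 1 (p ^ S), (-1 : R) ^ (i + 1) * ι (w i) * u ^ i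
  set H := Hs p ((a - 1).appr (2 * (S + 1)))
  have e : 2 * ι Da - Lg + Nq = ((E - Sg) - (Lg - Sg)) + (2 * (ι Da - ι H) - (ι X - 2 * ι H))
      - (p : R) ^ (S + 1) * (E * ι X) := by rw [h6]; ring
  rw [e]
  exact dvd_sub (dvd_add (dvd_sub (d1.trans hE2) h1)
    (dvd_sub (Dvd.dvd.mul_left h3 _) (d2.trans h4))) (Dvd.dvd.mul_right d2 _)

lemma exists_q (hp3 : 3 ≤ p) (ι : ℤ_[p] →+* R) (hp0 : ∀ k : ℕ, k ≠ 0 → (k : R) ≠ 0)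
    {a a' : ℤ_[p]} (h : IsDworkPrime p a a') {A A' : ℕ → ℤ_[p]}
    (hA : IsHGCoeff p 2 a A) (hA' : IsHGCoeff p 2 a' A') {u : R}
    {D : ℤ_[p] → ℚ_[p]} (hDcont : Continuous D)
    (hDval : ∀ m : ℕ, D (1 + (m : ℤ_[p])) =
      ∑ j ∈ (Finset.Icc 1 m).filter (fun j => ¬ (p ∣ j)), ((j : ℚ_[p]))⁻¹)
    {Da : ℤ_[p]} (hDa : (Da : ℚ_[p]) = D a)
    {w : ℕ → ℤ_[p]} (hw : ∀ i : ℕ, 1 ≤ i → ((i : ℤ_[p]) * (p : ℤ_[p])) * w i = (p : ℤ_[p]) ^ i)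
    {Lg : R}
    (hLg : ∀ m : ℕ, ∃ M : ℕ, ∀ n ≥ M, Lg - ∑ i ∈ Finset.Icc 1 n, (-1 : R) ^ (i + 1) * ι (w i) * u ^ i
      ∈ Ideal.span {(p : R) ^ m})
    {BG : ℕ → R} (hBG0 : BG 0 = 2 * ι Da - Lg)
    (hBGk : ∀ k : ℕ, 1 ≤ k → (k : R) * BG k =
      ι (A k) - (if p ∣ k then (1 + (p : R) * u) ^ (k / p) * ι (A' (k / p)) else 0)) :
    ∃ q : ℕ → R, LipE p 0 q ∧ (∀ i, BG i = ι (A i) * q i) ∧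
      (∀ i, ¬ p ∣ i → (i : R) * q i = 1) ∧
      (∀ k, ((p * k : ℕ) : R) * q (p * k) = 1 - (1 + (p : R) * u) ^ k * ι (rho p a (p * k))) := by
  have hp : 1 < p := (Fact.out : p.Prime).one_lt
  obtain ⟨v, hv, hvp⟩ := exists_v hp3
  obtain ⟨α, hα⟩ := newton_exists ι hv (acl_f ι a u)
  simp only [pow_zero, mul_zero, rho_zero, map_one, mul_one] at hα
  have hlim := qm_limit ι hp0 hv hα hDcont hDval hDa hw hLg
  set qm : ℕ → R := fun k => if k = 0 then BG 0 else - newtonQ ι v α (k - 1) with hqm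
  have hqml : ∀ s k t, (p : R) ^ (s + 1) ∣ qm (k + p ^ s * t) - qm k := by
    intro s k t
    rcases Nat.eq_zero_or_pos k with rfl | hk
    · rcases Nat.eq_zero_or_pos t with rfl | ht
      · simp
      · obtain ⟨S, hS, hd⟩ := hlim (s + 1)
        have hps : 1 ≤ p ^ s := Nat.one_le_pow _ _ (by omega)
        have h1 := newtonQ_lip ι hvp α s (p ^ s - 1) (t - 1)
        have h2 := newtonQ_lip ι hvp α s (p ^ s - 1) (p ^ (S - s) - 1)
        have e1 : p ^ s - 1 + p ^ s * (t - 1) = p ^ s * t - 1 := by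
          obtain ⟨t, rfl⟩ : ∃ t', t = t' + 1 := ⟨t - 1, by omega⟩
          rw [Nat.add_sub_cancel, mul_add, mul_one]; omega
        have e2 : p ^ s - 1 + p ^ s * (p ^ (S - s) - 1) = p ^ S - 1 := by
          have e3 : p ^ S = p ^ s * p ^ (S - s) := by rw [← pow_add]; congr 1; omega
          obtain ⟨t, ht⟩ : ∃ t', p ^ (S - s) = t' + 1 :=
            ⟨p ^ (S - s) - 1, by have := Nat.one_le_pow (S - s) p (by omega); omega⟩
          rw [e3, ht, Nat.add_sub_cancel, mul_add, mul_one]; omega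
        rw [e1] at h1
        rw [e2] at h2
        have hne : 0 + p ^ s * t ≠ 0 := by
          have := Nat.mul_pos hps ht; omega
        simp only [hqm, if_neg hne, if_true]
        rw [hBG0, zero_add]
        have := dvd_neg.2 (dvd_add (dvd_sub h1 h2) hd)
        convert this using 1
        ring
    · have h1 := newtonQ_lip ι hvp α s (k - 1) t
      have e1 : k - 1 + p ^ s * t = k + p ^ s * t - 1 := by omega
      rw [e1] at h1
      simp only [hqm]
      rw [if_neg (by omega), if_neg (by omega)]
      have := dvd_neg.2 h1
      convert this using 1
      ring
  have hqme : ∀ k : ℕ, ((p * k : ℕ) : R) * qm k =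
      1 - (1 + (p : R) * u) ^ k * ι (rho p a (p * k)) := by
    intro k
    rcases Nat.eq_zero_or_pos k with rfl | hk
    · simp [rho_zero]
    · have := hα (k - 1)
      rw [Nat.sub_add_cancel hk] at this
      simp only [hqm]
      rw [if_neg (by omega), this]
      push_cast; ring
  set q : ℕ → R := fun i => if p ∣ i then qm (i / p) else ι (Ring.inverse (i : ℤ_[p])) with hq
  have hqp : ∀ k, q (p * k) = qm k := by
    intro k
    simp only [hq]
    rw [if_pos (Dvd.intro _ rfl), Nat.mul_div_cancel_left _ (by omega)]
  have hinv : ∀ i : ℕ, ¬ p ∣ i → (i : ℤ_[p]) * Ring.inverse (i : ℤ_[p]) = 1 := by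
    intro i hi
    rw [← pdvd_nat1 (p := p)] at hi
    exact Ring.mul_inverse_cancel _ (isUnit_of_not_dvd hi)
  have hqu : ∀ i, ¬ p ∣ i → (i : R) * q i = 1 := by
    intro i hi
    simp only [hq]
    rw [if_neg hi]
    have := congrArg ι (hinv i hi)
    simpa using this
  refine ⟨q, ?_, ?_, hqu, ?_⟩
  · intro s i t
    rcases Nat.eq_zero_or_pos s with rfl | hs
    · simp
    obtain ⟨s, rfl⟩ : ∃ s', s = s' + 1 := ⟨s - 1, by omega⟩
    rw [add_zero]
    by_cases hi : p ∣ i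
    · obtain ⟨k, rfl⟩ := hi
      rw [show p * k + p ^ (s + 1) * t = p * (k + p ^ s * t) by ring, hqp, hqp]
      exact hqml s k t
    · have hi' : ¬ p ∣ i + p ^ (s + 1) * t := by
        rw [Nat.dvd_add_left]
        · exact hi
        · exact ⟨p ^ s * t, by ring⟩
      simp only [hq]
      rw [if_neg hi, if_neg hi', ← map_sub]
      have : (p : ℤ_[p]) ^ (s + 1) ∣ Ring.inverse ((i + p ^ (s + 1) * t : ℕ) : ℤ_[p]) -
          Ring.inverse (i : ℤ_[p]) := by
        have h1 := hinv _ hi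
        have h2 := hinv _ hi'
        refine ⟨- (t * Ring.inverse (i : ℤ_[p]) * Ring.inverse ((i + p ^ (s + 1) * t : ℕ) : ℤ_[p])), ?_⟩
        set y := Ring.inverse ((i + p ^ (s + 1) * t : ℕ) : ℤ_[p])
        set x := Ring.inverse (i : ℤ_[p])
        push_cast at h2
        linear_combination (-y) * h1 + x * h2
      have h3 := map_dvd ι this
      rwa [map_pow, map_natCast] at h3
  · intro i
    rcases Nat.eq_zero_or_pos i with rfl | hi
    · have hA0 := hA 0
      simp only [Nat.factorial_zero, Nat.cast_one, one_pow, one_mul, ascPochhammer_zero,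
        Polynomial.eval_one] at hA0
      rw [hA0, map_one, one_mul]
      have := hqp 0
      rw [mul_zero] at this
      rw [this]; simp [hqm]
    · apply mul_left_cancel₀ (hp0 i (by omega))
      rw [hBGk i hi]
      by_cases hpi : p ∣ i
      · rw [if_pos hpi]
        obtain ⟨k, rfl⟩ := hpi
        rw [Nat.mul_div_cancel_left _ (by omega), hqp]
        have h1 := coeff_split_le h hA hA' (Nat.zero_le _) k
        rw [zero_add] at h1
        have h2 : A' k = A (p * k) * rho p a (p * k) := by
          have := rho_mul a (p * k)
          rw [h1]
          linear_combination (-A' k) * this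
        have h3 := hqme k
        rw [h2, map_mul]
        linear_combination (-ι (A (p * k))) * h3
      · rw [if_neg hpi]
        have := hqu i hpi
        linear_combination (-ι (A i)) * this
  · intro k
    rw [hqp]
    exact hqme k

end part7

section part8
set_option linter.unusedSectionVars false
variable {p : ℕ} [Fact p.Prime]

lemma sharp_neg_sq (x : ℤ_[p]) : sharp p (-x) ^ 2 = sharp p x ^ 2 := by
  unfold sharp
  simp only [dvd_neg]
  split_ifs <;> ring

lemma curly_reflect {M : ℕ} (hM : 1 ≤ M) {a : ℤ_[p]} {i k : ℕ}
    (h : (p : ℤ_[p]) ^ M ∣ a + (k : ℤ_[p]) + (i : ℤ_[p])) :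
    (p : ℤ_[p]) ^ M ∣ curly p a i ^ 2 * curly p 1 k ^ 2 - curly p 1 (k + i) ^ 2 := by
  rw [curly_add 1 k i, mul_pow, mul_comm (curly p 1 k ^ 2)]
  refine mul_congr ?_ (by simp)
  have h1 : curly p (-((k : ℤ_[p]) + i)) i ^ 2 = curly p (1 + (k : ℤ_[p])) i ^ 2 := by
    rw [curly_eq, curly_eq, ← Finset.prod_range_reflect, ← Finset.prod_pow, ← Finset.prod_pow]
    apply Finset.prod_congr rfl
    intro j hj
    have hj' := Finset.mem_range.1 hj
    rw [← sharp_neg_sq]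
    congr 2
    have : ((i - 1 - j : ℕ) : ℤ_[p]) = (i : ℤ_[p]) - 1 - j := by
      rw [Nat.cast_sub (by omega), Nat.cast_sub (by omega)]; simp
    rw [this]; ring
  rw [← h1, sq, sq]
  have h2 := curly_congr hM (α := a) (β := -((k : ℤ_[p]) + i)) (by convert h using 1; ring) i
  exact mul_congr h2 h2

lemma rho_reflect {M : ℕ} (hM : 1 ≤ M) {a : ℤ_[p]} {i k : ℕ}
    (h : (p : ℤ_[p]) ^ M ∣ a + (k : ℤ_[p]) + (i : ℤ_[p])) :
    (p : ℤ_[p]) ^ M ∣ rho p a i - rho p a k := by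
  have h1 := curly_reflect hM h
  have h2 := curly_reflect hM (a := a) (i := k) (k := i) (by convert h using 1; ring)
  rw [add_comm i k] at h2
  have h3 := congr_trans h2 (congr_symm h1)
  have hr : ∀ k, rho p a k * curly p a k ^ 2 = curly p 1 k ^ 2 := by
    intro k
    unfold rho
    have := curly_mul_cinv a k
    linear_combination (curly p 1 k) ^ 2 * (curly p a k * cinv p a k + 1) * this
  have hu := ((isUnit_curly a i).pow 2).mul ((isUnit_curly a k).pow 2)
  apply unit_cancel hu
  convert h3 using 1
  linear_combination (curly p a k ^ 2) * hr i - (curly p a i ^ 2) * hr k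

lemma bhat_congr {a a' : ℤ_[p]} (h : IsDworkPrime p a a') {A A' : ℕ → ℤ_[p]}
    (hA : IsHGCoeff p 2 a A) (hA' : IsHGCoeff p 2 a' A') {u chat : Wp p}
    (hchat : (1 + (p : Wp p) * u) * chat = 1)
    {cpwhat : ℤ_[p] → Wp p} (hcpwhat : IsCpow p chat cpwhat)
    {Bhat : ℕ → Wp p} (hBhat : IsBhat p 2 a a' A A' cpwhat Bhat)
    {q : ℕ → Wp p} (hq1 : ∀ i, ¬ p ∣ i → (i : Wp p) * q i = 1)
    (hq2 : ∀ k, ((p * k : ℕ) : Wp p) * q (p * k) =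
      1 - (1 + (p : Wp p) * u) ^ k * iota p (rho p a (p * k)))
    {M : ℕ} (hM : 1 ≤ M) {i k : ℕ} (hik : (p : ℤ_[p]) ^ M ∣ a + (k : ℤ_[p]) + (i : ℤ_[p])) :
    (p : Wp p) ^ M ∣ iota p (a + (k : ℤ_[p])) * (Bhat k + iota p (A k) * q i) := by
  have hp : 1 < p := (Fact.out : p.Prime).one_lt
  have hl := dl_lt a
  have hik' := map_dvd (iota p) hik
  simp only [map_pow, map_natCast, map_add] at hik'
  obtain ⟨z, hz⟩ := hik'
  have hB := hBhat k
  have hdiv : (p : ℤ_[p]) ∣ a + (k : ℤ_[p]) ↔ p ∣ i := by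
    rw [← pdvd_nat1 (p := p)]
    have h1 : (p : ℤ_[p]) ∣ a + (k : ℤ_[p]) + (i : ℤ_[p]) := (dvd_pow_self _ (by omega)).trans hik
    exact ⟨fun h2 => (dvd_add_right h2).1 h1, fun h2 => (dvd_add_left h2).1 h1⟩
  rw [map_add, map_natCast]
  by_cases hi : p ∣ i
  · have hc : dl p a ≤ k ∧ p ∣ k - dl p a := by
      have h2 := (dvd_add_nat_iff a k).1 (hdiv.2 hi)
      by_cases hk : dl p a ≤ k
      · refine ⟨hk, ?_⟩
        rw [show k + p - dl p a = (k - dl p a) + p by omega] at h2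
        exact (Nat.dvd_add_left (dvd_refl p)).1 h2
      · exact absurd (Nat.le_of_dvd (by omega) h2) (by omega)
    rw [if_pos hc] at hB
    obtain ⟨k', hk'⟩ := hc.2
    obtain ⟨i', rfl⟩ := hi
    have hkk : k = dl p a + p * k' := by omega
    rw [hk', Nat.mul_div_cancel_left _ (by omega : 0 < p), pow_mul, neg_one_sq, one_pow,
      one_mul] at hB
    have h1 := coeff_split_le h hA hA' (le_refl _) k'
    rw [← hkk] at h1
    have h2 : A' k' = A k * rho p a k := by
      have := rho_mul a k
      rw [h1]
      linear_combination (-A' k') * this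
    have h3 := map_dvd (iota p) (rho_reflect hM hik)
    simp only [map_pow, map_natCast, map_sub] at h3
    -- powers of c
    set c := 1 + (p : Wp p) * u with hcdef
    set n₀ := ((k' : ℤ_[p]) + a').appr M with hn₀
    have h4 := hcpwhat ((k' : ℤ_[p]) + a') M
    rw [Ideal.mem_span_singleton, ← hn₀] at h4
    have h5 : p ^ (M - 1) ∣ i' + n₀ := by
      rw [← pdvd_nat]
      have e1 : (p : ℤ_[p]) ^ (M - 1) ∣ a' + k' + i' := by
        have hne : (p : ℤ_[p]) ≠ 0 := PadicInt.prime_p.ne_zero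
        rw [← mul_dvd_mul_iff_left hne, ← pow_succ', Nat.sub_add_cancel hM]
        convert hik using 1
        unfold IsDworkPrime at h
        rw [hkk]
        push_cast
        linear_combination h
      have e2 := PadicInt.appr_spec M ((k' : ℤ_[p]) + a')
      rw [Ideal.mem_span_singleton, ← hn₀] at e2
      have e3 := dvd_sub e1 ((pow_dvd_pow (p : ℤ_[p]) (Nat.sub_le M 1)).trans e2)
      convert e3 using 1
      push_cast; ring
    obtain ⟨t, ht⟩ := h5
    have h6 : (p : Wp p) ^ M ∣ c ^ (i' + n₀) - 1 := by
      have e1 := dvd_sub_pow_of_dvd_sub (R := Wp p) (p := p) (a := c) (b := 1)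
        ⟨u, by rw [hcdef]; ring⟩ (M - 1)
      rw [Nat.sub_add_cancel hM, one_pow] at e1
      rw [ht, pow_mul]
      refine e1.trans ?_
      have := sub_dvd_pow_sub_pow (c ^ p ^ (M - 1)) 1 t
      rwa [one_pow] at this
    have hcn : c ^ n₀ * chat ^ n₀ = 1 := by rw [← mul_pow, hchat, one_pow]
    have h7 : (p : Wp p) ^ M ∣ c ^ i' - chat ^ n₀ := by
      have := Dvd.dvd.mul_left h6 (chat ^ n₀)
      convert this using 1
      rw [pow_add]
      linear_combination (-c ^ i') * hcn
    have h8 : (p : Wp p) ^ M ∣ c ^ i' - cpwhat ((k' : ℤ_[p]) + a') :=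
      congr_trans h7 (congr_symm h4)
    have h9 := Dvd.dvd.mul_left (mul_congr h8 h3) (iota p (A k))
    have h10 : (p : Wp p) ^ M ∣ (p : Wp p) ^ M * (z * iota p (A k) * q (p * i')) := Dvd.intro _ rfl
    have h11 := dvd_add h9 h10
    convert h11 using 1
    rw [h2, map_mul] at hB
    have h12 := hq2 i'
    linear_combination hB - (iota p (A k)) * h12 + (iota p (A k) * q (p * i')) * hz
  · have hc : ¬ (dl p a ≤ k ∧ p ∣ k - dl p a) := by
      rintro ⟨hk, k', hk'⟩
      apply hi
      rw [← hdiv]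
      have hkk : k = dl p a + p * k' := by omega
      unfold IsDworkPrime at h
      refine ⟨a' + k', ?_⟩
      rw [hkk]; push_cast
      linear_combination -h
    rw [if_neg hc, sub_zero] at hB
    have h1 := hq1 i hi
    refine ⟨z * iota p (A k) * q i, ?_⟩
    linear_combination hB + (iota p (A k) * q i) * hz - (iota p (A k)) * h1

lemma cancel_exists {R : Type*} [CommRing R] [IsDomain R] (ι : ℤ_[p] →+* R) (hp0 : (p : R) ≠ 0)
    {y : ℤ_[p]} (hy : y ≠ 0) :
    ∃ e : ℕ, ∀ (n : ℕ) (x : ℤ_[p]) (z : R), x ∣ y → (p : R) ^ (n + e) ∣ ι x * z → (p : R) ^ n ∣ z := by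
  refine ⟨y.valuation, fun n x z hx hd => ?_⟩
  have h1 : (p : R) ^ (n + y.valuation) ∣ ι y * z :=
    hd.trans (mul_dvd_mul_right (map_dvd ι hx) z)
  have hy2 : ι y = ι (PadicInt.unitCoeff hy : ℤ_[p]) * (p : R) ^ y.valuation := by
    conv_lhs => rw [PadicInt.unitCoeff_spec hy]
    rw [map_mul, map_pow, map_natCast]
  rw [hy2, pow_add, mul_comm ((p : R) ^ n), mul_comm (ι _), mul_assoc] at h1
  have h2 := (mul_dvd_mul_iff_left (pow_ne_zero _ hp0)).1 h1
  exact (((PadicInt.unitCoeff hy).isUnit.map ι).dvd_mul_left).1 h2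

lemma coeff_congr {a : ℤ_[p]} {A : ℕ → ℤ_[p]} (hA : IsHGCoeff p 2 a A) {M L : ℕ}
    (h : (p : ℤ_[p]) ^ M ∣ a + (L : ℤ_[p])) (k : ℕ) :
    (p : ℤ_[p]) ^ M ∣ ((k.factorial : ℕ) : ℤ_[p]) ^ 2 *
      (A k - ((L.choose k : ℕ) : ℤ_[p]) ^ 2) := by
  have h1 := hA k
  have h2 := hgcoeff_choose (p := p) L k
  have h3 : (p : ℤ_[p]) ^ M ∣ (ascPochhammer ℤ_[p] k).eval a -
      (ascPochhammer ℤ_[p] k).eval (-(L : ℤ_[p])) := by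
    refine Dvd.dvd.trans ?_ (Polynomial.sub_dvd_eval_sub _ _ _)
    rwa [sub_neg_eq_add]
  have h4 := mul_congr h3 h3
  convert h4 using 1
  rw [mul_sub, h1]
  simp only [] at h2
  rw [sq, h2]; ring

end part8

set_option synthInstance.maxHeartbeats 800000 in
set_option maxHeartbeats 1600000 in
/-- transformation formula: for `a = m₀/N`, `p > N`, `s = 2`,
`σ(t) = c t^p`, `σ̂(t) = c⁻¹ t^p`, one has
`ℱ^{(σ)}_{a,a}(t) = −ℱ̂^{(σ̂)}_{a,a}(t⁻¹)` in `W⟨t,t⁻¹,h(t)⁻¹⟩`; concretely, for every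
`n ≥ 1`, `G^{(σ)}_{a,a}(t)_{<p^n} · ω_n(F_{a,a}(t)_{<p^n}) =
−ω_n(Ĝ^{(σ̂)}_{a,a}(t)_{<p^n}) · F_{a,a}(t)_{<p^n}` in `R_n`. -/
theorem statement17 (p : ℕ) [Fact p.Prime] (N : ℕ) (hN : 2 ≤ N) (hpN : N < p)
    (m₀ : ℕ) (hm₀ : 0 < m₀) (hm₀N : m₀ < N)
    (a : ℤ_[p]) (haN : (N : ℤ_[p]) * a = (m₀ : ℤ_[p]))
    (as : ℕ → ℤ_[p]) (has0 : as 0 = a) (hasD : ∀ i, IsDworkPrime p (as i) (as (i + 1)))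
    (r : ℕ) (hr : 1 ≤ r) (har : as r = a)
    (AF : ℕ → ℕ → ℤ_[p]) (hAF : ∀ i, IsHGCoeff p 2 (as i) (AF i))
    (hW : Polynomial (Wp p))
    (hhW : hW = (∏ i ∈ Finset.range r, (PowerSeries.mk (AF i)).trunc p).map (iota p))
    (u c chat : Wp p) (hc : c = 1 + (p : Wp p) * u) (hchat : c * chat = 1)
    (cpwhat : ℤ_[p] → Wp p) (hcpwhat : IsCpow p chat cpwhat)
    (Bhat : ℕ → Wp p) (hBhat : IsBhat p 2 a (as 1) (AF 0) (AF 1) cpwhat Bhat)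
    (D : ℤ_[p] → ℚ_[p]) (hDcont : Continuous D)
    (hDval : ∀ m : ℕ, D (1 + (m : ℤ_[p])) =
      ∑ j ∈ (Finset.Icc 1 m).filter (fun j => ¬ (p ∣ j)), ((j : ℚ_[p]))⁻¹)
    (Da : ℤ_[p]) (hDa : (Da : ℚ_[p]) = D a)
    (w : ℕ → ℤ_[p]) (hw : ∀ i : ℕ, 1 ≤ i → ((i : ℤ_[p]) * (p : ℤ_[p])) * w i = (p : ℤ_[p]) ^ i)
    (Lg : Wp p)
    (hLg : WLim p (fun n => ∑ i ∈ Finset.Icc 1 n, (-1 : Wp p) ^ (i + 1) * iota p (w i) * u ^ i) Lg)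
    (BG : ℕ → Wp p) (hBG0 : BG 0 = 2 * iota p Da - Lg)
    (hBGk : ∀ k : ℕ, 1 ≤ k → (k : Wp p) * BG k =
      iota p (AF 0 k) - (if p ∣ k then c ^ (k / p) * iota p (AF 1 (k / p)) else 0)) :
    ∀ n : ℕ, 1 ≤ n → ∀ ω : Rn p hW n →+* Rn p hW n,
      (∀ f : LaurentPolynomial (Qn p n),
        ω (mkRn p hW n f) = mkRn p hW n (LaurentPolynomial.invert f)) →
      toRn p hW n ((PowerSeries.mk BG).trunc (p ^ n)) *
          ω (toRn p hW n ((PowerSeries.mk (fun k => iota p (AF 0 k))).trunc (p ^ n))) =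
        - (ω (toRn p hW n ((PowerSeries.mk Bhat).trunc (p ^ n))) *
            toRn p hW n ((PowerSeries.mk (fun k => iota p (AF 0 k))).trunc (p ^ n))) := by
  intro n hn ω hω
  have hp3 : 3 ≤ p := by omega
  have hp1 : 1 < p := by omega
  have hinj : Function.Injective (iota p) := by
    unfold iota
    rw [RingHom.coe_comp]
    exact (WittVector.map_injective _ (algebraMap (ZMod p) (Fbar p)).injective).comp
      (WittVector.equiv p).symm.injective
  have hp0 : ∀ k : ℕ, k ≠ 0 → (k : Wp p) ≠ 0 := by
    intro k hk h
    have h1 : iota p (k : ℤ_[p]) = iota p 0 := by rw [map_natCast, map_zero, h]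
    exact hk (by exact_mod_cast hinj h1)
  have hDw : IsDworkPrime p a (as 1) := by have := hasD 0; rwa [has0] at this
  have hA : IsHGCoeff p 2 a (AF 0) := by have := hAF 0; rwa [has0] at this
  have hA' := hAF 1
  subst hc
  obtain ⟨q, hq, hqB, hq1, hq2⟩ := exists_q hp3 (iota p) hp0 hDw hA hA' hDcont hDval hDa hw hLg
    hBG0 hBGk
  set y : ℤ_[p] := ∏ k ∈ Finset.range (p ^ n), (((k.factorial : ℕ) : ℤ_[p]) ^ 2 *
    (a + (k : ℤ_[p]))) with hy
  have hy0 : y ≠ 0 := by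
    rw [hy, Finset.prod_ne_zero_iff]
    intro k _
    refine mul_ne_zero (pow_ne_zero _ ?_) ?_
    · exact_mod_cast Nat.factorial_ne_zero k
    · intro h
      have h1 : ((m₀ + N * k : ℕ) : ℤ_[p]) = 0 := by
        push_cast; linear_combination (N : ℤ_[p]) * h - haN
      have h2 : m₀ + N * k = 0 := by exact_mod_cast h1
      omega
  obtain ⟨e, he⟩ := cancel_exists (iota p) (hp0 p (by omega)) hy0
  have hM1 : 1 ≤ n + e := by omega
  set M := n + e with hM
  set L := (-a).appr M + p ^ M with hL
  have hLa : (p : ℤ_[p]) ^ M ∣ a + (L : ℤ_[p]) := by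
    have h1 := PadicInt.appr_spec M (-a)
    rw [Ideal.mem_span_singleton] at h1
    have h2 := dvd_sub (dvd_refl ((p : ℤ_[p]) ^ M)) h1
    rw [hL]
    convert h2 using 1
    push_cast; ring
  have hkL : ∀ k < p ^ n, k ≤ L := by
    intro k hk
    have : p ^ n ≤ p ^ M := Nat.pow_le_pow_right (by omega) (by omega)
    omega
  have hf : ∀ k < p ^ n, (p : Wp p) ^ n ∣ iota p (AF 0 k) - ((L.choose k : ℕ) : Wp p) ^ 2 := by
    intro k hk
    apply he n (((k.factorial : ℕ) : ℤ_[p]) ^ 2)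
    · rw [hy]
      exact (Dvd.intro _ rfl).trans (Finset.dvd_prod_of_mem _ (Finset.mem_range.2 hk))
    · have := map_dvd (iota p) (coeff_congr hA hLa k)
      simp only [map_mul, map_sub, map_pow, map_natCast] at this ⊢
      exact this
  have hb : ∀ k < p ^ n, (p : Wp p) ^ n ∣ Bhat k + iota p (AF 0 k) * q (L - k) := by
    intro k hk
    apply he n (a + (k : ℤ_[p]))
    · rw [hy]
      exact (Dvd.intro_left _ rfl).trans (Finset.dvd_prod_of_mem _ (Finset.mem_range.2 hk))
    · apply bhat_congr hDw hA hA' hchat hcpwhat hBhat hq1 hq2 hM1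
      rw [Nat.cast_sub (hkL k hk)]
      convert hLa using 1
      ring
  have hqs : ∀ k < p ^ n, (p : Wp p) ^ n ∣ q (L + (p ^ M - 1) * k) - q (L - k) := by
    intro k hk
    have h5 := hq M (L - k) k
    have hk' := hkL k hk
    have e : L - k + p ^ M * k = L + (p ^ M - 1) * k := by
      have h6 : 1 ≤ p ^ M := Nat.one_le_pow _ _ (by omega)
      have : p ^ M * k = (p ^ M - 1) * k + k := by
        conv_lhs => rw [← Nat.sub_add_cancel h6]
        ring
      rw [this]; omega
    rw [e] at h5
    exact (pow_dvd_pow _ (by omega)).trans h5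
  have main := laurent_main (iota p) (hp0 p (by omega)) n L M (by omega) q hq
  have l1 : lam (Ideal.span {(p : Wp p) ^ n}) (PowerSeries.trunc (p ^ n)
      (PowerSeries.mk (fun k => iota p (AF 0 k)))) =
      lam _ (PowerSeries.trunc (p ^ n) (Gser (Wp p) L (fun _ => 1))) := by
    apply lam_trunc_congr
    intro k hk
    rw [Ideal.mem_span_singleton]
    simpa [Gser] using hf k hk
  have l2 : lam (Ideal.span {(p : Wp p) ^ n}) (PowerSeries.trunc (p ^ n) (PowerSeries.mk BG)) =
      lam _ (PowerSeries.trunc (p ^ n) (Gser (Wp p) L q)) := by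
    apply lam_trunc_congr
    intro k hk
    rw [Ideal.mem_span_singleton, Gser, PowerSeries.coeff_mk, PowerSeries.coeff_mk, hqB k, ← sub_mul]
    exact Dvd.dvd.mul_right (hf k hk) _
  have l3 : lam (Ideal.span {(p : Wp p) ^ n}) (PowerSeries.trunc (p ^ n) (PowerSeries.mk Bhat)) =
      - lam _ (PowerSeries.trunc (p ^ n) (Gser (Wp p) L (fun k => q (L + (p ^ M - 1) * k)))) := by
    rw [← map_neg, ← map_neg]
    apply lam_trunc_congr
    intro k hk
    rw [Ideal.mem_span_singleton, map_neg, Gser, PowerSeries.coeff_mk, PowerSeries.coeff_mk]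
    have := dvd_add (dvd_sub (hb k hk) (Dvd.dvd.mul_right (hf k hk) (q (L - k))))
      (Dvd.dvd.mul_left (hqs k hk) (((L.choose k : ℕ) : Wp p) ^ 2))
    convert this using 1
    ring
  have hto : ∀ f, toRn p hW n f = mkRn p hW n (lam (Ideal.span {(p : Wp p) ^ n}) f) := fun f => rfl
  rw [hto, hto, hto, hω, hω, l1, l2, l3, ← map_mul, main, map_neg, map_neg, neg_mul, neg_neg,
    ← map_mul]

end HGP
end

section
/- (Transformation formula for Dwork's p-adic hypergeometric function.) Let N ≥ 2 be an integer, p > N a prime, and a = m₀/N ∈ ℤ_p with m₀ ∈ ℤ, 0 < m₀ < N; take s = 2 throughout. Let l ∈ {0,…,p−1} be the unique integer with a + l ≡ 0 mod p. Let r ≥ 1 be an integer with a^{(r)} = a and put h(t) := Π_{i=0}^{r−1} F_{a^{(i)},a^{(i)}}(t)_{<p}. Then ℱ^Dw_{a,a}(t) = t^l ℱ^Dw_{a,a}(t^{−1}) in W⟨t, t^{−1}, h(t)^{−1}⟩ := lim←_n R_n; concretely, for every n ≥ 1 the identity F_{a,a}(t)_{<p^n} · ω_n([F_{a′,a′}(t^p)]_{<p^n})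 = t^l · ω_n(F_{a,a}(t)_{<p^n}) · [F_{a′,a′}(t^p)]_{<p^n} holds in R_n, where ω_n: R_n → R_n is the ring homomorphism with ω_n(f(t)) = f(t^{−1}). -/
open scoped Classical

namespace HGP

/-- `z ↦ 1` if `p ∣ z`, and `z²` otherwise. -/
noncomputable def tau (p : ℕ) [Fact p.Prime] (z : ℤ_[p]) : ℤ_[p] :=
  if (p : ℤ_[p]) ∣ z then 1 else z ^ 2

/-- Functions which are 1-Lipschitz, phrased through divisibility. -/
def Lip (p : ℕ) [Fact p.Prime] (f : ℤ_[p] → ℤ_[p]) : Prop :=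
  ∀ d x y, d ∣ x - y → d ∣ f x - f y

/-- Two-variable version of `Lip`. -/
def Lip2 (p : ℕ) [Fact p.Prime] (f : ℤ_[p] → ℤ_[p] → ℤ_[p]) : Prop :=
  ∀ d x x' y y', d ∣ x - x' → d ∣ y - y' → d ∣ f x y - f x' y'

theorem dvd_all_eq_zero {p : ℕ} [Fact p.Prime] {x : ℤ_[p]} (h : ∀ n : ℕ, (p : ℤ_[p]) ^ n ∣ x) :
    x = 0 := by
  rw [← PadicInt.ext_of_toZModPow]
  intro n
  rw [map_zero, ← RingHom.mem_ker, PadicInt.ker_toZModPow, Ideal.mem_span_singleton]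
  exact h n

theorem dvd_sub_appr {p : ℕ} [Fact p.Prime] (x : ℤ_[p]) (n : ℕ) :
    (p : ℤ_[p]) ^ n ∣ x - (x.appr n : ℤ_[p]) := by
  have := PadicInt.appr_spec n x
  rwa [Ideal.mem_span_singleton] at this

theorem tau_unit {p : ℕ} [Fact p.Prime] (z : ℤ_[p]) : IsUnit (tau p z) := by
  unfold tau
  split_ifs with h
  · exact isUnit_one
  · apply IsUnit.pow
    by_contra hz
    apply h
    have : z ∈ IsLocalRing.maximalIdeal ℤ_[p] := hz
    rwa [PadicInt.maximalIdeal_eq_span_p, Ideal.mem_span_singleton] at this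

theorem tau_neg {p : ℕ} [Fact p.Prime] (z : ℤ_[p]) : tau p (-z) = tau p z := by
  simp [tau]

theorem tau_congr {p : ℕ} [Fact p.Prime] {n : ℕ} {x y : ℤ_[p]} (h : (p : ℤ_[p]) ^ n ∣ x - y) :
    (p : ℤ_[p]) ^ n ∣ tau p x - tau p y := by
  rcases Nat.eq_zero_or_pos n with rfl | hn
  · simp
  have hp : (p : ℤ_[p]) ∣ x - y := (dvd_pow_self _ hn.ne').trans h
  have : (p : ℤ_[p]) ∣ x ↔ (p : ℤ_[p]) ∣ y := (dvd_iff_dvd_of_dvd_sub hp)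
  unfold tau
  by_cases hx : (p : ℤ_[p]) ∣ x
  · rw [if_pos hx, if_pos (this.1 hx)]; simp
  · rw [if_neg hx, if_neg (fun hh => hx (this.2 hh)), sq_sub_sq]
    exact h.mul_left _

theorem dvd_iff_zmod {p : ℕ} [Fact p.Prime] (n : ℕ) (x : ℤ_[p]) :
    (p : ℤ_[p]) ^ n ∣ x ↔ PadicInt.toZModPow n x = 0 := by
  rw [← RingHom.mem_ker, PadicInt.ker_toZModPow, Ideal.mem_span_singleton]

theorem p_dvd_iff_not_unit {p : ℕ} [Fact p.Prime] (n : ℕ) (hn : 1 ≤ n) (x : ℤ_[p]) :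
    (p : ℤ_[p]) ∣ x ↔ ¬ IsUnit (PadicInt.toZModPow n x) := by
  constructor
  · rintro ⟨y, rfl⟩ hu
    rw [map_mul] at hu
    have h1 := isUnit_of_mul_isUnit_left hu
    have h2 := h1.pow n
    rw [← map_pow, (dvd_iff_zmod n _).1 dvd_rfl] at h2
    have : Fact (1 < p ^ n) := ⟨Nat.one_lt_pow (by omega) (Fact.out : p.Prime).one_lt⟩
    exact not_isUnit_zero h2
  · intro h
    by_contra hx
    apply h
    apply IsUnit.map
    by_contra hz
    apply hx
    have : x ∈ IsLocalRing.maximalIdeal ℤ_[p] := hz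
    rwa [PadicInt.maximalIdeal_eq_span_p, Ideal.mem_span_singleton] at this

theorem prod_units_sq {R : Type*} [CommRing R] [Fintype R] :
    ∏ z : R, (if IsUnit z then z ^ 2 else 1) = 1 := by
  rw [← Finset.prod_filter]
  have h : ∏ z ∈ Finset.univ.filter (fun z : R => IsUnit z), z ^ 2 = ∏ u : Rˣ, (u : R) ^ 2 := by
    symm
    apply Finset.prod_bij (fun (u : Rˣ) _ => (u : R))
    · intro u _; simp
    · intro u _ v _ h; exact Units.ext h
    · intro b hb
      obtain ⟨u, hu⟩ := (Finset.mem_filter.1 hb).2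
      exact ⟨u, Finset.mem_univ _, hu⟩
    · intro u _; rfl
  rw [h]
  have h2 : ∏ u : Rˣ, u ^ 2 = 1 := by
    have h3 : ∏ u : Rˣ, u⁻¹ = ∏ u : Rˣ, u := Fintype.prod_equiv (Equiv.inv Rˣ) _ _ (fun u => rfl)
    rw [Finset.prod_pow, sq]
    nth_rewrite 1 [← h3]
    rw [Finset.prod_inv_distrib]
    simp
  have := congrArg (fun u : Rˣ => (u : R)) h2
  simpa using this

theorem prod_tau_block {p : ℕ} [Fact p.Prime] (n : ℕ) :
    (p : ℤ_[p]) ^ n ∣ (∏ i ∈ Finset.range (p ^ n), tau p ((i : ℤ_[p]) + 1)) - 1 := by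
  rcases Nat.eq_zero_or_pos n with rfl | hn
  · simp
  rw [dvd_iff_zmod, map_sub, map_prod, map_one, sub_eq_zero]
  have : NeZero (p ^ n) := ⟨pow_ne_zero _ (Fact.out : p.Prime).ne_zero⟩
  rw [← prod_units_sq (R := ZMod (p ^ n))]
  apply Finset.prod_bij' (fun (i : ℕ) _ => (i : ZMod (p ^ n)) + 1) (fun z _ => (z - 1).val)
  · intro i _; simp
  · intro z _; simpa using ZMod.val_lt _
  · intro i hi
    simp only [add_sub_cancel_right]
    exact ZMod.val_cast_of_lt (Finset.mem_range.1 hi)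
  · intro z _; simp
  · intro i _
    unfold tau
    have := p_dvd_iff_not_unit n hn ((i : ℤ_[p]) + 1)
    rw [map_add, map_natCast, map_one] at this
    by_cases h : (p : ℤ_[p]) ∣ (i : ℤ_[p]) + 1
    · rw [if_pos h, if_neg (this.1 h), map_one]
    · rw [if_neg h, if_pos (by by_contra hh; exact h (this.2 hh))]
      simp

/-- `∏_{1 ≤ i ≤ k, p ∤ i} i²`. -/
noncomputable def dfun (p : ℕ) [Fact p.Prime] (k : ℕ) : ℤ_[p] :=
  ∏ i ∈ Finset.range k, tau p ((i : ℤ_[p]) + 1)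

theorem dfun_add {p : ℕ} [Fact p.Prime] (n k : ℕ) :
    (p : ℤ_[p]) ^ n ∣ dfun p (k + p ^ n) - dfun p k := by
  induction k with
  | zero => simpa [dfun] using prod_tau_block n
  | succ k ih =>
    have e1 : dfun p (k + 1 + p ^ n) = dfun p (k + p ^ n) * tau p (((k + p ^ n : ℕ) : ℤ_[p]) + 1) := by
      rw [show k + 1 + p ^ n = (k + p ^ n) + 1 by ring, dfun, Finset.prod_range_succ]; rfl
    have e2 : dfun p (k + 1) = dfun p k * tau p ((k : ℤ_[p]) + 1) := by
      rw [dfun, Finset.prod_range_succ]; rfl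
    have h : (p : ℤ_[p]) ^ n ∣ tau p (((k + p ^ n : ℕ) : ℤ_[p]) + 1) - tau p ((k : ℤ_[p]) + 1) :=
      tau_congr (by push_cast; simp)
    rw [e1, e2, show ∀ a b c d : ℤ_[p], a * b - c * d = (a - c) * b + c * (b - d) by intros; ring]
    exact dvd_add (ih.mul_right _) (h.mul_left _)

theorem dfun_congr {p : ℕ} [Fact p.Prime] (n k k' : ℕ) (h : (p : ℤ_[p]) ^ n ∣ (k : ℤ_[p]) - k') :
    (p : ℤ_[p]) ^ n ∣ dfun p k - dfun p k' := by
  have key : ∀ k c : ℕ, (p : ℤ_[p]) ^ n ∣ dfun p (k + p ^ n * c) - dfun p k := by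
    intro k c
    induction c with
    | zero => simp
    | succ c ih =>
      have := dfun_add (p := p) n (k + p ^ n * c)
      rw [show k + p ^ n * (c + 1) = k + p ^ n * c + p ^ n by ring]
      have h3 := dvd_add this ih
      rwa [sub_add_sub_cancel] at h3
  have main : ∀ k k' : ℕ, k' ≤ k → (p : ℤ_[p]) ^ n ∣ (k : ℤ_[p]) - k' →
      (p : ℤ_[p]) ^ n ∣ dfun p k - dfun p k' := by
    intro k k' hle hd
    rw [← Nat.cast_sub hle, dvd_iff_zmod, map_natCast, ZMod.natCast_eq_zero_iff] at hd
    obtain ⟨c, hc⟩ := hd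
    have := key k' c
    rwa [← hc, Nat.add_sub_cancel' hle] at this
  rcases le_total k' k with h1 | h1
  · exact main k k' h1 h
  · rw [dvd_sub_comm]; rw [dvd_sub_comm] at h; exact main k' k h1 h

theorem dfun_unit {p : ℕ} [Fact p.Prime] (k : ℕ) : IsUnit (dfun p k) := by
  unfold dfun
  exact Finset.prod_induction _ IsUnit (fun _ _ => IsUnit.mul) isUnit_one (fun _ _ => tau_unit _)

theorem dvd_of_pow {p : ℕ} [Fact p.Prime] {x y : ℤ_[p]}
    (h : ∀ n : ℕ, (p : ℤ_[p]) ^ n ∣ x → (p : ℤ_[p]) ^ n ∣ y) (d : ℤ_[p]) (hd : d ∣ x) : d ∣ y := by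
  by_cases h0 : d = 0
  · subst h0
    rw [zero_dvd_iff] at hd ⊢
    subst hd
    exact dvd_all_eq_zero (fun n => h n (dvd_zero _))
  · have := PadicInt.unitCoeff_spec h0
    rw [this] at hd ⊢
    rw [Units.mul_left_dvd] at hd ⊢
    exact h _ hd

/-- Existence of the extension `D` of `dfun` to `ℤ_p`. -/
theorem exists_D (p : ℕ) [Fact p.Prime] : ∃ D : ℤ_[p] → ℤ_[p], Lip p D ∧ D 0 = 1 ∧
    (∀ x, D (x + 1) = D x * tau p (x + 1)) ∧ ∀ x, IsUnit (D x) := by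
  have hex : ∀ x : ℤ_[p], ∃ L : ℤ_[p], ∀ n, (p : ℤ_[p]) ^ n ∣ dfun p (x.appr n) - L := by
    intro x
    have hpre : IsPrecomplete (IsLocalRing.maximalIdeal ℤ_[p]) ℤ_[p] := inferInstance
    obtain ⟨L, hL⟩ := hpre.prec' (fun n => dfun p (x.appr n)) (by
      intro m n hmn
      rw [SModEq.sub_mem, PadicInt.maximalIdeal_eq_span_p, Ideal.span_singleton_pow, smul_eq_mul,
        Ideal.mul_top, Ideal.mem_span_singleton]
      apply dfun_congr
      have h1 := dvd_sub_appr x m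
      have h2 := (pow_dvd_pow (p : ℤ_[p]) hmn).trans (dvd_sub_appr x n)
      have := dvd_sub h2 h1
      rwa [sub_sub_sub_cancel_left] at this)
    refine ⟨L, fun n => ?_⟩
    have := hL n
    rwa [SModEq.sub_mem, PadicInt.maximalIdeal_eq_span_p, Ideal.span_singleton_pow, smul_eq_mul,
        Ideal.mul_top, Ideal.mem_span_singleton] at this
  choose D hD using hex
  have hk : ∀ (x : ℤ_[p]) (k n : ℕ), (p : ℤ_[p]) ^ n ∣ x - k →
      (p : ℤ_[p]) ^ n ∣ D x - dfun p k := by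
    intro x k n h
    have h1 := dvd_sub h (dvd_sub_appr x n)
    rw [sub_sub_sub_cancel_left] at h1
    have h2 := dfun_congr n _ _ h1
    have h4 := dvd_sub h2 (hD x n)
    rwa [sub_sub_sub_cancel_left] at h4
  have hkk : ∀ k : ℕ, D k = dfun p k := fun k =>
    sub_eq_zero.1 (dvd_all_eq_zero (fun n => hk k k n (by simp)))
  refine ⟨D, ?_, ?_, ?_, ?_⟩
  · intro d x y hd
    refine dvd_of_pow (x := x - y) (fun n hn => ?_) d hd
    have h1 := dvd_sub_appr x n
    have h2 := hk x _ n h1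
    have h3 : (p : ℤ_[p]) ^ n ∣ y - (x.appr n : ℤ_[p]) := by
      have := dvd_sub h1 hn
      rwa [sub_sub_sub_cancel_left] at this
    have h4 := dvd_sub h2 (hk y _ n h3)
    rwa [sub_sub_sub_cancel_right] at h4
  · have := hkk 0
    simpa [dfun] using this
  · intro x
    apply sub_eq_zero.1
    apply dvd_all_eq_zero
    intro n
    have h1 := dvd_sub_appr x n
    have h2 := hk x _ n h1
    have h3 := hk (x + 1) (x.appr n + 1) n (by push_cast; simpa using h1)
    have h4 : (p : ℤ_[p]) ^ n ∣ tau p (x + 1) - tau p ((x.appr n : ℤ_[p]) + 1) :=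
      tau_congr (by simpa using h1)
    have e2 : dfun p (x.appr n + 1) = dfun p (x.appr n) * tau p ((x.appr n : ℤ_[p]) + 1) := by
      rw [dfun, Finset.prod_range_succ]; rfl
    rw [e2] at h3
    have h5 := dvd_sub h3 (dvd_add (h2.mul_right (tau p (x + 1))) (h4.mul_left (dfun p (x.appr n))))
    convert h5 using 1
    ring
  · intro x
    have h2 := hk x _ 1 (dvd_sub_appr x 1)
    by_contra hz
    have h3 : D x ∈ IsLocalRing.maximalIdeal ℤ_[p] := hz
    rw [PadicInt.maximalIdeal_eq_span_p, Ideal.mem_span_singleton] at h3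
    rw [pow_one] at h2
    have h4 := dvd_sub h3 h2
    rw [sub_sub_cancel] at h4
    exact PadicInt.prime_p.not_isUnit (isUnit_of_dvd_unit h4 (dfun_unit _))

theorem exists_V (p : ℕ) [Fact p.Prime] (a : ℤ_[p]) : ∃ V : ℤ_[p] → ℤ_[p], Lip p V ∧ V 0 = 1 ∧
    (∀ x, tau p (x + 1) * V (x + 1) = tau p (a + x) * V x) ∧ ∀ x, V (-a - x) = V x := by
  obtain ⟨D, hL, h0, hD, hu⟩ := exists_D p
  choose E hE using fun x => (hu x).exists_right_inv
  have hEL : Lip p E := by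
    intro d x y h
    have : E x - E y = E x * E y * (D y - D x) := by
      linear_combination E x * hE y * (-1) + E y * hE x
    rw [this]
    have h2 := hL d x y h
    rw [dvd_sub_comm] at h2
    exact h2.mul_left _
  refine ⟨fun x => D (-a) * (E x * E (-a - x)), ?_, ?_, ?_, ?_⟩
  · intro d x y h
    have h1 := hEL d x y h
    have h2 := hEL d (-a - x) (-a - y) (by rwa [sub_sub_sub_cancel_left, dvd_sub_comm])
    have h3 := (dvd_add (h1.mul_right (E (-a - x))) (h2.mul_left (E y))).mul_left (D (-a))
    convert h3 using 1
    ring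
  · have := hE 0
    rw [h0, one_mul] at this
    simp [this, hE]
  · intro x
    have h1 := hD x
    have h2 := hD (-a - (x + 1))
    rw [show -a - (x + 1) + 1 = -(a + x) by ring, tau_neg] at h2
    have e1 := hE x
    have e2 := hE (x + 1)
    have e3 := hE (-a - (x + 1))
    have e4 := hE (-(a + x))
    have g : -a - x = -(a + x) := by ring
    simp only [g]
    generalize E (-(a + x)) = E4 at *
    generalize E (-a - (x + 1)) = E3 at *
    generalize E (x + 1) = E2 at *
    generalize E x = E1 at *
    generalize D (-(a + x)) = D4 at *
    generalize D (-a - (x + 1)) = D3 at *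
    generalize D (x + 1) = D2 at *
    generalize D x = D1 at *
    have s1 : E2 * tau p (x + 1) = E1 := by
      rw [h1] at e2
      linear_combination E1 * e2 - E2 * tau p (x + 1) * e1
    have s2 : E4 * tau p (a + x) = E3 := by
      rw [h2] at e4
      linear_combination E3 * e4 - E4 * tau p (a + x) * e3
    rw [← s1, ← s2]
    ring
  · intro x
    simp only [sub_sub_cancel]
    ring

/-- The recurrence of the squared hypergeometric coefficients. -/
def Rec (p : ℕ) [Fact p.Prime] (a : ℤ_[p]) (A : ℕ → ℤ_[p]) : Prop :=
  A 0 = 1 ∧ ∀ k : ℕ, ((k : ℤ_[p]) + 1) ^ 2 * A (k + 1) = (a + k) ^ 2 * A k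

theorem Rec.of_coeff {p : ℕ} [Fact p.Prime] {a : ℤ_[p]} {A : ℕ → ℤ_[p]} (h : IsHGCoeff p 2 a A) :
    Rec p a A := by
  refine ⟨by simpa using h 0, fun k => ?_⟩
  have h1 := h k
  have h2 := h (k + 1)
  rw [ascPochhammer_succ_eval, Nat.factorial_succ] at h2
  push_cast at h2
  have hne : ((k.factorial : ℤ_[p])) ^ 2 ≠ 0 :=
    pow_ne_zero _ (Nat.cast_ne_zero.2 (Nat.factorial_ne_zero k))
  apply mul_left_cancel₀ hne
  linear_combination h2 - (a + k) ^ 2 * h1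

theorem sum_digits {M : Type*} [AddCommMonoid M] (p q : ℕ) (f : ℕ → M) :
    ∑ i ∈ Finset.range (p * q), f i =
      ∑ i0 ∈ Finset.range p, ∑ i1 ∈ Finset.range q, f (i0 + p * i1) := by
  rw [Finset.sum_comm]
  induction q with
  | zero => simp
  | succ q ih =>
    rw [Finset.sum_range_succ, ← ih, Nat.mul_succ, Finset.sum_range_add]
    simp only [add_comm]

/-- Carry indicator. -/
def ee (l x : ℕ) : ℕ := if x ≤ l then 0 else 1

/-- The reflection `x ↦ l - x mod p` on `{0,…,p-1}`. -/
def sig (p l x : ℕ) : ℕ := l + p * ee l x - x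

theorem sig_cast {p l x : ℕ} (hx : x < p) {R : Type*} [CommRing R] :
    (sig p l x : R) = l + p * ee l x - x := by
  unfold sig
  rw [Nat.cast_sub]
  · push_cast; rfl
  · unfold ee; split_ifs <;> simp <;> omega

theorem sig_lt {p l x : ℕ} (hl : l < p) (hx : x < p) : sig p l x < p := by
  unfold sig ee; split_ifs <;> simp <;> omega

theorem ee_sig {p l x : ℕ} (hl : l < p) (hx : x < p) : ee l (sig p l x) = ee l x := by
  unfold sig ee; split_ifs <;> simp_all <;> omega

theorem sig_sig {p l x : ℕ} (hl : l < p) (hx : x < p) : sig p l (sig p l x) = x := by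
  rw [sig, ee_sig hl hx]
  unfold sig ee; split_ifs <;> simp <;> omega

/-- The data needed for one Dwork step. -/
structure Setup (p : ℕ) [Fact p.Prime] (a a' : ℤ_[p]) (l : ℕ) (A A' : ℕ → ℤ_[p])
    (V : ℤ_[p] → ℤ_[p]) : Prop where
  hp : (p : ℤ_[p]) * a' = a + l
  hl : l < p
  rA : Rec p a A
  rA' : Rec p a' A'
  lip : Lip p V
  v0 : V 0 = 1
  vs : ∀ x, tau p (x + 1) * V (x + 1) = tau p (a + x) * V x
  vr : ∀ x, V (-a - x) = V x

section
variable {p : ℕ} [Fact p.Prime] {a a' : ℤ_[p]} {l : ℕ} {A A' : ℕ → ℤ_[p]} {V : ℤ_[p] → ℤ_[p]}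

theorem p_dvd_natCast (k : ℕ) : (p : ℤ_[p]) ∣ (k : ℤ_[p]) ↔ p ∣ k := by
  have := dvd_iff_zmod (p := p) 1 (k : ℤ_[p])
  rw [pow_one, map_natCast, ZMod.natCast_eq_zero_iff, pow_one] at this
  exact this

theorem tau_of_dvd {z : ℤ_[p]} (h : (p : ℤ_[p]) ∣ z) : tau p z = 1 := if_pos h
theorem tau_of_not_dvd {z : ℤ_[p]} (h : ¬ (p : ℤ_[p]) ∣ z) : tau p z = z ^ 2 := if_neg h

theorem Setup.p_dvd (S : Setup p a a' l A A' V) (i0 i1 : ℕ) (hi : i0 < p) :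
    (p : ℤ_[p]) ∣ a + ((i0 + p * i1 : ℕ) : ℤ_[p]) ↔ i0 = l := by
  have hl := S.hl
  have e : a + ((i0 + p * i1 : ℕ) : ℤ_[p]) = p * (a' + i1) + ((i0 : ℤ_[p]) - l) := by
    push_cast; linear_combination -S.hp
  rw [e, dvd_add_right (dvd_mul_right _ _)]
  constructor
  · intro h
    rcases le_total l i0 with hle | hle
    · rw [← Nat.cast_sub hle, p_dvd_natCast] at h
      have := Nat.eq_zero_of_dvd_of_lt h (by omega)
      omega
    · rw [dvd_sub_comm, ← Nat.cast_sub hle, p_dvd_natCast] at h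
      have := Nat.eq_zero_of_dvd_of_lt h (by omega)
      omega
  · rintro rfl; simp

/-- The decomposition of the coefficients along digits. -/
theorem Setup.digit (S : Setup p a a' l A A' V) : ∀ i1 i0 : ℕ, i0 < p →
    A (i0 + p * i1) = A' i1 * (p * (a' + i1)) ^ (2 * ee l i0) * V ((i0 : ℤ_[p]) + p * i1) := by
  have hl := S.hl
  have hp0 : (p : ℤ_[p]) ≠ 0 := Nat.cast_ne_zero.2 (Fact.out : p.Prime).ne_zero
  have hp1 := (Fact.out : p.Prime).one_lt
  have step : ∀ i1 i0 : ℕ, i0 + 1 < p →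
      A (i0 + p * i1) = A' i1 * (p * (a' + i1)) ^ (2 * ee l i0) * V ((i0 : ℤ_[p]) + p * i1) →
      A (i0 + 1 + p * i1) = A' i1 * (p * (a' + i1)) ^ (2 * ee l (i0 + 1)) *
        V (((i0 + 1 : ℕ) : ℤ_[p]) + p * i1) := by
    intro i1 i0 hi h
    have hr := S.rA.2 (i0 + p * i1)
    have hv := S.vs ((i0 + p * i1 : ℕ) : ℤ_[p])
    have hnd : ¬ (p : ℤ_[p]) ∣ ((i0 + p * i1 : ℕ) : ℤ_[p]) + 1 := by
      have := p_dvd_natCast (p := p) (i0 + p * i1 + 1)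
      push_cast at this ⊢
      rw [this, show i0 + p * i1 + 1 = (i0 + 1) + p * i1 by ring,
        (Nat.dvd_add_iff_left (dvd_mul_right p i1)).symm]
      intro hd
      have := Nat.le_of_dvd (by omega) hd
      omega
    rw [tau_of_not_dvd hnd] at hv
    have hne : (((i0 + p * i1 : ℕ) : ℤ_[p]) + 1) ^ 2 ≠ 0 := by
      apply pow_ne_zero
      exact_mod_cast Nat.succ_ne_zero (i0 + p * i1)
    have key : (p * (a' + i1)) ^ (2 * ee l (i0 + 1)) * tau p (a + ((i0 + p * i1 : ℕ) : ℤ_[p]))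
        = (a + ((i0 + p * i1 : ℕ) : ℤ_[p])) ^ 2 * (p * (a' + i1)) ^ (2 * ee l i0) := by
      have hd := S.p_dvd i0 i1 (by omega)
      by_cases hil : i0 = l
      · rw [tau_of_dvd (hd.2 hil)]
        have e1 : ee l (i0 + 1) = 1 := by simp [ee]; omega
        have e2 : ee l i0 = 0 := by simp [ee]; omega
        have e3 : a + ((i0 + p * i1 : ℕ) : ℤ_[p]) = p * (a' + i1) := by
          subst hil; push_cast; linear_combination -S.hp
        rw [e1, e2, e3]; simp
      · rw [tau_of_not_dvd (fun hh => hil (hd.1 hh))]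
        have e1 : ee l (i0 + 1) = ee l i0 := by unfold ee; split_ifs <;> omega
        rw [e1]; ring
    rw [show i0 + 1 + p * i1 = i0 + p * i1 + 1 by ring]
    rw [show (((i0 + 1 : ℕ) : ℤ_[p]) + p * i1) = ((i0 + p * i1 : ℕ) : ℤ_[p]) + 1 by push_cast; ring]
    rw [show ((i0 : ℤ_[p]) + p * i1) = ((i0 + p * i1 : ℕ) : ℤ_[p]) by push_cast; ring] at h
    apply mul_left_cancel₀ hne
    rw [hr, h]
    linear_combination (-A' i1 * (p * (a' + i1)) ^ (2 * ee l (i0 + 1))) * hv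
      - A' i1 * V ((i0 + p * i1 : ℕ) : ℤ_[p]) * key
  have row : ∀ i1 : ℕ,
      A (0 + p * i1) = A' i1 * (p * (a' + i1)) ^ (2 * ee l 0) * V (((0 : ℕ) : ℤ_[p]) + p * i1) →
      ∀ i0 : ℕ, i0 < p →
      A (i0 + p * i1) = A' i1 * (p * (a' + i1)) ^ (2 * ee l i0) * V ((i0 : ℤ_[p]) + p * i1) := by
    intro i1 h i0
    induction i0 with
    | zero => intro _; exact h
    | succ i0 ih => intro hi; exact step i1 i0 hi (ih (by omega))
  intro i1
  induction i1 with
  | zero =>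
    apply row
    simp [ee, S.rA.1, S.rA'.1, S.v0]
  | succ i1 ih =>
    apply row
    have h := ih (p - 1) (by omega)
    have hk1 : p - 1 + p * i1 + 1 = p * (i1 + 1) := by
      rw [Nat.mul_add]; omega
    have hr := S.rA.2 (p - 1 + p * i1)
    have hv := S.vs ((p - 1 + p * i1 : ℕ) : ℤ_[p])
    have hc : ((p - 1 + p * i1 : ℕ) : ℤ_[p]) + 1 = p * (i1 + 1) := by
      exact_mod_cast hk1
    rw [show (((p - 1 : ℕ) : ℤ_[p]) + p * i1) = ((p - 1 + p * i1 : ℕ) : ℤ_[p]) by push_cast; ring] at h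
    have hne : (p * ((i1 : ℤ_[p]) + 1)) ^ 2 ≠ 0 := by
      apply pow_ne_zero
      apply mul_ne_zero hp0
      exact_mod_cast Nat.succ_ne_zero i1
    have key : (p * (a' + i1)) ^ 2 * tau p (a + ((p - 1 + p * i1 : ℕ) : ℤ_[p]))
        = (a + ((p - 1 + p * i1 : ℕ) : ℤ_[p])) ^ 2 * (p * (a' + i1)) ^ (2 * ee l (p - 1)) := by
      have hd := S.p_dvd (p - 1) i1 (by omega)
      by_cases hil : p - 1 = l
      · rw [tau_of_dvd (hd.2 hil)]
        have e2 : ee l (p - 1) = 0 := by simp [ee]; omega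
        have e3 : a + ((p - 1 + p * i1 : ℕ) : ℤ_[p]) = p * (a' + i1) := by
          rw [hil]; push_cast; linear_combination -S.hp
        rw [e2, e3]; simp
      · rw [tau_of_not_dvd (fun hh => hil (hd.1 hh))]
        have e1 : ee l (p - 1) = 1 := by simp [ee]; omega
        rw [e1]; ring
    rw [hc, tau_of_dvd (dvd_mul_right _ _)] at hv
    rw [hk1, hc] at hr
    have e0 : ee l 0 = 0 := by simp [ee]
    have hr' := S.rA'.2 i1
    rw [e0, zero_add]
    push_cast
    rw [zero_add]
    apply mul_left_cancel₀ hne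
    rw [hr, h]
    generalize V ((p - 1 + p * i1 : ℕ) : ℤ_[p]) = V1 at *
    generalize V (p * ((i1 : ℤ_[p]) + 1)) = V2 at *
    linear_combination (-(p : ℤ_[p]) ^ 2 * V2) * hr' - A' i1 * V1 * key
      - (p * (a' + i1)) ^ 2 * A' i1 * hv

theorem Setup.digit' (S : Setup p a a' l A A' V) (i1 i0 : ℕ) (hi : i0 < p) :
    A (i0 + p * i1) = A' (i1 + ee l i0) * (p * ((i1 + ee l i0 : ℕ) : ℤ_[p])) ^ (2 * ee l i0) *
      V ((i0 : ℤ_[p]) + p * i1) := by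
  rw [S.digit i1 i0 hi]
  rcases (show ee l i0 = 0 ∨ ee l i0 = 1 by unfold ee; split_ifs <;> simp) with h | h
  · rw [h]; simp
  · rw [h]
    have := S.rA'.2 i1
    push_cast
    linear_combination (-(p : ℤ_[p]) ^ 2 * V ((i0 : ℤ_[p]) + p * i1)) * this

/-- First-variable weight. -/
noncomputable def WW (p : ℕ) [Fact p.Prime] (l : ℕ) (V : ℤ_[p] → ℤ_[p]) (i0 : ℕ) (X : ℤ_[p]) : ℤ_[p] :=
  V ((i0 : ℤ_[p]) - p * ee l i0 + X) * X ^ (2 * ee l i0)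

/-- Second-variable weight. -/
noncomputable def VV (p : ℕ) [Fact p.Prime] (a' : ℤ_[p]) (l : ℕ) (V : ℤ_[p] → ℤ_[p]) (j0 : ℕ) (Y : ℤ_[p]) :
    ℤ_[p] :=
  V ((j0 : ℤ_[p]) + Y) * (p * a' + Y) ^ (2 * ee l j0)

theorem Setup.WW_refl (S : Setup p a a' l A A' V) {i0 : ℕ} (hi : i0 < p) (Y : ℤ_[p]) :
    WW p l V i0 (-(p * a') - Y) = VV p a' l V (sig p l i0) Y := by
  unfold WW VV
  rw [ee_sig S.hl hi, ← S.vr, sig_cast hi, S.hp]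
  congr 1
  · congr 1; ring
  · rw [pow_mul, pow_mul]; congr 1; ring

theorem Setup.VV_refl (S : Setup p a a' l A A' V) {j0 : ℕ} (hj : j0 < p) (X : ℤ_[p]) :
    VV p a' l V j0 (-(p * a') - X) = WW p l V (sig p l j0) X := by
  have := S.WW_refl (sig_lt S.hl hj) (-(p * a') - X)
  rw [sig_sig S.hl hj, sub_sub_cancel] at this
  exact this.symm

theorem Lip.pow_id (k : ℕ) : Lip p (fun x => x ^ k) := fun _ x y h => h.trans (sub_dvd_pow_sub_pow x y k)

theorem Lip.mul {f g : ℤ_[p] → ℤ_[p]} (hf : Lip p f) (hg : Lip p g) : Lip p (fun x => f x * g x) := by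
  intro d x y h
  have h3 := dvd_add ((hf d x y h).mul_right (g x)) ((hg d x y h).mul_left (f y))
  convert h3 using 1
  ring

theorem Lip.shift {f : ℤ_[p] → ℤ_[p]} (hf : Lip p f) (c : ℤ_[p]) : Lip p (fun x => f (c + x)) := by
  intro d x y h
  exact hf d _ _ (by simpa using h)

theorem Lip2.mul {f g : ℤ_[p] → ℤ_[p] → ℤ_[p]} (hf : Lip2 p f) (hg : Lip2 p g) :
    Lip2 p (fun x y => f x y * g x y) := by
  intro d x x' y y' h h'
  have h3 := dvd_add ((hf d x x' y y' h h').mul_right (g x y)) ((hg d x x' y y' h h').mul_left (f x' y'))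
  convert h3 using 1
  ring

theorem Setup.WW_lip (S : Setup p a a' l A A' V) (i0 : ℕ) : Lip p (WW p l V i0) :=
  (S.lip.shift _).mul (Lip.pow_id _)

theorem Setup.VV_lip (S : Setup p a a' l A A' V) (i0 : ℕ) : Lip p (VV p a' l V i0) :=
  (S.lip.shift _).mul ((Lip.pow_id (p := p) (2 * ee l i0)).shift _)

theorem Setup.A_eq_VV (S : Setup p a a' l A A' V) (i1 i0 : ℕ) (hi : i0 < p) :
    A (i0 + p * i1) = A' i1 * VV p a' l V i0 (p * i1) := by
  rw [S.digit i1 i0 hi, VV]; ring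

theorem Setup.A_eq_WW (S : Setup p a a' l A A' V) (i1 i0 : ℕ) (hi : i0 < p) :
    A (i0 + p * i1) = A' (i1 + ee l i0) * WW p l V i0 (p * ((i1 + ee l i0 : ℕ) : ℤ_[p])) := by
  rw [S.digit' i1 i0 hi, WW]
  rw [show (i0 : ℤ_[p]) - p * ee l i0 + p * ((i1 + ee l i0 : ℕ) : ℤ_[p]) = i0 + p * i1 by
    push_cast; ring]
  ring

/-- Shift of the summation range. -/
theorem Setup.shift (S : Setup p a a' l A A' V) (n i0 : ℕ) (hi : i0 < p) (K : ℕ → ℤ_[p]) :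
    (p : ℤ_[p]) ^ (n + 1) ∣ ∑ i ∈ Finset.range (p ^ n), A (i0 + p * i) * K (i + ee l i0) -
      ∑ x ∈ Finset.range (p ^ n), A' x * WW p l V i0 (p * x) * K x := by
  simp_rw [S.A_eq_WW _ i0 hi]
  rcases (show ee l i0 = 0 ∨ ee l i0 = 1 by unfold ee; split_ifs <;> simp) with h | h
  · simp [h]
  · rw [h]
    have := Finset.sum_range_succ' (fun x : ℕ => A' x * WW p l V i0 (p * x) * K x) (p ^ n)
    rw [Finset.sum_range_succ] at this
    have e : ∑ i ∈ Finset.range (p ^ n), A' (i + 1) * WW p l V i0 (p * ((i + 1 : ℕ) : ℤ_[p])) *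
          K (i + 1) - ∑ x ∈ Finset.range (p ^ n), A' x * WW p l V i0 (p * x) * K x =
        A' (p ^ n) * WW p l V i0 (p * ((p ^ n : ℕ) : ℤ_[p])) * K (p ^ n) -
          A' 0 * WW p l V i0 (p * ((0 : ℕ) : ℤ_[p])) * K 0 := by
      linear_combination -this
    rw [e]
    have z : WW p l V i0 (p * ((0 : ℕ) : ℤ_[p])) = 0 := by simp [WW, h]
    rw [z, mul_zero, zero_mul, sub_zero]
    apply Dvd.dvd.mul_right
    apply Dvd.dvd.mul_left
    unfold WW
    apply Dvd.dvd.mul_left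
    rw [h]
    push_cast
    rw [← pow_succ']
    exact dvd_pow_self _ (by norm_num)

theorem Lip2.divide {Φ : ℤ_[p] → ℤ_[p] → ℤ_[p]} (h : Lip2 p Φ) :
    ∃ Ψ : ℤ_[p] → ℤ_[p] → ℤ_[p], Lip2 p Ψ ∧ ∀ x y, Φ (p * x) (p * y) = Φ 0 0 + p * Ψ x y := by
  have hp0 : (p : ℤ_[p]) ≠ 0 := Nat.cast_ne_zero.2 (Fact.out : p.Prime).ne_zero
  have hd : ∀ x y, ∃ z, Φ (p * x) (p * y) - Φ 0 0 = p * z := by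
    intro x y
    exact h p _ _ _ _ (by simp) (by simp)
  choose Ψ hΨ using hd
  refine ⟨Ψ, ?_, fun x y => by rw [← hΨ]; ring⟩
  intro d x x' y y' h1 h2
  have h3 := h (p * d) (p * x) (p * x') (p * y) (p * y')
    (by rw [← mul_sub]; exact mul_dvd_mul_left _ h1) (by rw [← mul_sub]; exact mul_dvd_mul_left _ h2)
  have e : Φ (p * x) (p * y) - Φ (p * x') (p * y') = p * (Ψ x y - Ψ x' y') := by
    linear_combination hΨ x y - hΨ x' y'
  rw [e] at h3
  exact (mul_dvd_mul_iff_left hp0).1 h3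

/-- Weighted correlation sums. -/
noncomputable def TT (p : ℕ) [Fact p.Prime] (q : ℕ) (m : ℤ) (A : ℕ → ℤ_[p])
    (Ψ : ℤ_[p] → ℤ_[p] → ℤ_[p]) : ℤ_[p] :=
  ∑ i ∈ Finset.range q, ∑ j ∈ Finset.range q,
    if (i : ℤ) - j = m then A i * A j * Ψ i j else 0

/-- The same sums, after passing to digits. -/
noncomputable def UU (p : ℕ) [Fact p.Prime] (q : ℕ) (c m : ℤ) (A : ℕ → ℤ_[p])
    (Φ : ℤ_[p] → ℤ_[p] → ℤ_[p]) : ℤ_[p] :=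
  ∑ x ∈ Finset.range q, ∑ y ∈ Finset.range q,
    if c + p * ((x : ℤ) - y) = m then A x * A y * Φ (p * x) (p * y) else 0

/-- The inductive claim. -/
def Claim (p : ℕ) [Fact p.Prime] (n : ℕ) (a : ℤ_[p]) (A : ℕ → ℤ_[p]) : Prop :=
  ∀ (m : ℤ) (Ψ : ℤ_[p] → ℤ_[p] → ℤ_[p]), Lip2 p Ψ →
    (p : ℤ_[p]) ^ n ∣ TT p (p ^ n) m A Ψ - TT p (p ^ n) m A (fun x y => Ψ (-a - y) (-a - x))

theorem core {n : ℕ} (hc : Claim p n a' A') (c m : ℤ) {Φ : ℤ_[p] → ℤ_[p] → ℤ_[p]} (h : Lip2 p Φ) :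
    (p : ℤ_[p]) ^ (n + 1) ∣ UU p (p ^ n) c m A' Φ -
      UU p (p ^ n) c m A' (fun X Y => Φ (-(p * a') - Y) (-(p * a') - X)) := by
  obtain ⟨Ψ, hΨ, he⟩ := h.divide
  have hpz : (p : ℤ) ≠ 0 := Nat.cast_ne_zero.2 (Fact.out : p.Prime).ne_zero
  by_cases hm : (p : ℤ) ∣ m - c
  · obtain ⟨m1, hm1⟩ := hm
    have h1 := mul_dvd_mul_left (p : ℤ_[p]) (hc m1 Ψ hΨ)
    rw [← pow_succ'] at h1
    convert h1 using 1
    unfold UU TT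
    simp only [← Finset.sum_sub_distrib, Finset.mul_sum]
    refine Finset.sum_congr rfl fun x _ => Finset.sum_congr rfl fun y _ => ?_
    have hiff : (c + p * ((x : ℤ) - y) = m) ↔ ((x : ℤ) - y = m1) := by
      constructor
      · intro hh
        apply mul_left_cancel₀ hpz
        linarith
      · intro hh; rw [hh]; linarith
    by_cases hxy : (x : ℤ) - y = m1
    · rw [if_pos (hiff.2 hxy), if_pos (hiff.2 hxy), if_pos hxy, if_pos hxy]
      have e1 := he x y
      have e2 := he (-a' - y) (-a' - x)
      rw [show (p : ℤ_[p]) * (-a' - y) = -(p * a') - p * y by ring,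
        show (p : ℤ_[p]) * (-a' - x) = -(p * a') - p * x by ring] at e2
      rw [e1, e2]; ring
    · rw [if_neg (fun hh => hxy (hiff.1 hh)), if_neg (fun hh => hxy (hiff.1 hh)), if_neg hxy,
        if_neg hxy]
      simp
  · have hz : ∀ Φ, UU p (p ^ n) c m A' Φ = 0 := by
      intro Φ
      unfold UU
      refine Finset.sum_eq_zero fun x _ => Finset.sum_eq_zero fun y _ => if_neg ?_
      intro hh
      exact hm ⟨(x : ℤ) - y, by linarith⟩
    rw [hz, hz]; simp

/-- The part of `TT` with prescribed last digits. -/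
noncomputable def TD (p : ℕ) [Fact p.Prime] (q : ℕ) (m : ℤ) (A : ℕ → ℤ_[p])
    (Ψ : ℤ_[p] → ℤ_[p] → ℤ_[p]) (i0 j0 : ℕ) : ℤ_[p] :=
  ∑ i ∈ Finset.range q, ∑ j ∈ Finset.range q,
    if ((i0 + p * i : ℕ) : ℤ) - ((j0 + p * j : ℕ) : ℤ) = m then
      A (i0 + p * i) * A (j0 + p * j) * Ψ (i0 + p * i : ℕ) (j0 + p * j : ℕ) else 0

theorem TT_digits (q : ℕ) (m : ℤ) (A : ℕ → ℤ_[p]) (Ψ : ℤ_[p] → ℤ_[p] → ℤ_[p]) :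
    TT p (p * q) m A Ψ =
      ∑ i0 ∈ Finset.range p, ∑ j0 ∈ Finset.range p, TD p q m A Ψ i0 j0 := by
  unfold TT TD
  rw [sum_digits]
  refine Finset.sum_congr rfl fun i0 _ => ?_
  simp_rw [sum_digits]
  rw [Finset.sum_comm]

/-- The weight after one step. -/
noncomputable def PH (p : ℕ) [Fact p.Prime] (a' : ℤ_[p]) (l : ℕ) (V : ℤ_[p] → ℤ_[p])
    (Ψ : ℤ_[p] → ℤ_[p] → ℤ_[p]) (i0 j0 : ℕ) (X Y : ℤ_[p]) : ℤ_[p] :=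
  WW p l V i0 X * VV p a' l V j0 Y * Ψ ((i0 : ℤ_[p]) - p * ee l i0 + X) ((j0 : ℤ_[p]) + Y)

theorem Setup.PH_lip (S : Setup p a a' l A A' V) {Ψ : ℤ_[p] → ℤ_[p] → ℤ_[p]} (h : Lip2 p Ψ)
    (i0 j0 : ℕ) : Lip2 p (PH p a' l V Ψ i0 j0) := by
  have h1 : Lip2 p (fun X _ => WW p l V i0 X) := fun d x x' y y' hx _ => S.WW_lip i0 d x x' hx
  have h2 : Lip2 p (fun _ Y => VV p a' l V j0 Y) := fun d x x' y y' _ hy => S.VV_lip j0 d y y' hy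
  have h3 : Lip2 p (fun X Y => Ψ ((i0 : ℤ_[p]) - p * ee l i0 + X) ((j0 : ℤ_[p]) + Y)) :=
    fun d x x' y y' hx hy => h d _ _ _ _ (by simpa using hx) (by simpa using hy)
  exact (h1.mul h2).mul h3

theorem Setup.half (S : Setup p a a' l A A' V) (n : ℕ) (m : ℤ) (Ψ : ℤ_[p] → ℤ_[p] → ℤ_[p])
    (i0 j0 : ℕ) (hi : i0 < p) (hj : j0 < p) :
    (p : ℤ_[p]) ^ (n + 1) ∣ TD p (p ^ n) m A Ψ i0 j0 -
      UU p (p ^ n) ((i0 : ℤ) - p * ee l i0 - j0) m A' (PH p a' l V Ψ i0 j0) := by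
  have := S.shift n i0 hi (fun x => ∑ j ∈ Finset.range (p ^ n),
    if ((i0 : ℤ) - p * ee l i0 - j0) + p * ((x : ℤ) - j) = m then
      A (j0 + p * j) * Ψ ((i0 : ℤ_[p]) - p * ee l i0 + p * x) ((j0 : ℤ_[p]) + p * j) else 0)
  convert this using 2
  · unfold TD
    refine Finset.sum_congr rfl fun i _ => ?_
    rw [Finset.mul_sum]
    refine Finset.sum_congr rfl fun j _ => ?_
    rw [mul_ite, mul_zero]
    apply if_congr
    · push_cast
      constructor <;> intro h <;> linarith
    · push_cast
      rw [show (i0 : ℤ_[p]) - p * ee l i0 + p * (i + ee l i0) = i0 + p * i by ring]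
      ring
    · rfl
  · unfold UU
    refine Finset.sum_congr rfl fun i _ => ?_
    rw [Finset.mul_sum]
    refine Finset.sum_congr rfl fun j _ => ?_
    rw [mul_ite, mul_zero, S.A_eq_VV j j0 hj]
    apply if_congr Iff.rfl _ rfl
    unfold PH
    ring

theorem Setup.pair (S : Setup p a a' l A A' V) {n : ℕ} (hc : Claim p n a' A') (m : ℤ)
    {Ψ : ℤ_[p] → ℤ_[p] → ℤ_[p]} (h : Lip2 p Ψ) (i0 j0 : ℕ) (hi : i0 < p) (hj : j0 < p) :
    (p : ℤ_[p]) ^ (n + 1) ∣ TD p (p ^ n) m A Ψ i0 j0 -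
      TD p (p ^ n) m A (fun x y => Ψ (-a - y) (-a - x)) (sig p l j0) (sig p l i0) := by
  have h1 := S.half n m Ψ i0 j0 hi hj
  have h2 := core hc ((i0 : ℤ) - p * ee l i0 - j0) m (S.PH_lip h i0 j0)
  have h3 := S.half n m (fun x y => Ψ (-a - y) (-a - x)) (sig p l j0) (sig p l i0)
    (sig_lt S.hl hj) (sig_lt S.hl hi)
  have e1 : ((sig p l j0 : ℕ) : ℤ) - p * ee l (sig p l j0) - (sig p l i0 : ℕ) =
      (i0 : ℤ) - p * ee l i0 - j0 := by
    rw [ee_sig S.hl hj, sig_cast hi, sig_cast hj]; ring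
  have e2 : PH p a' l V (fun x y => Ψ (-a - y) (-a - x)) (sig p l j0) (sig p l i0) =
      fun X Y => PH p a' l V Ψ i0 j0 (-(p * a') - Y) (-(p * a') - X) := by
    funext X Y
    unfold PH
    beta_reduce
    rw [S.WW_refl hi, S.VV_refl hj, ee_sig S.hl hj, sig_cast hi, sig_cast hj]
    rw [show -a - ((l : ℤ_[p]) + p * ee l i0 - i0 + Y) = i0 - p * ee l i0 + (-(p * a') - Y) by
        linear_combination S.hp,
      show -a - ((l : ℤ_[p]) + p * ee l j0 - j0 - p * ee l j0 + X) = j0 + (-(p * a') - X) by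
        linear_combination S.hp]
    ring
  rw [e1, e2] at h3
  have := dvd_sub (dvd_add h1 h2) h3
  convert this using 1
  ring

theorem sum_sig (hl : l < p) (f : ℕ → ℤ_[p]) :
    ∑ i ∈ Finset.range p, f (sig p l i) = ∑ i ∈ Finset.range p, f i := by
  apply Finset.sum_bij' (fun i _ => sig p l i) (fun i _ => sig p l i)
  · intro i hi; exact Finset.mem_range.2 (sig_lt hl (Finset.mem_range.1 hi))
  · intro i hi; exact Finset.mem_range.2 (sig_lt hl (Finset.mem_range.1 hi))
  · intro i hi; exact sig_sig hl (Finset.mem_range.1 hi)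
  · intro i hi; exact sig_sig hl (Finset.mem_range.1 hi)
  · intro i _; rfl

theorem Setup.claim_succ (S : Setup p a a' l A A' V) {n : ℕ} (hc : Claim p n a' A') :
    Claim p (n + 1) a A := by
  intro m Ψ h
  rw [pow_succ' p n, TT_digits, TT_digits]
  have e : ∑ i0 ∈ Finset.range p, ∑ j0 ∈ Finset.range p,
        TD p (p ^ n) m A (fun x y => Ψ (-a - y) (-a - x)) i0 j0 =
      ∑ i0 ∈ Finset.range p, ∑ j0 ∈ Finset.range p,
        TD p (p ^ n) m A (fun x y => Ψ (-a - y) (-a - x)) (sig p l j0) (sig p l i0) := by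
    rw [Finset.sum_comm]
    rw [← sum_sig S.hl]
    refine Finset.sum_congr rfl fun i0 _ => ?_
    rw [← sum_sig S.hl]
  rw [e, ← Finset.sum_sub_distrib]
  refine Finset.dvd_sum fun i0 hi => ?_
  rw [← Finset.sum_sub_distrib]
  refine Finset.dvd_sum fun j0 hj => ?_
  exact S.pair hc m h i0 j0 (Finset.mem_range.1 hi) (Finset.mem_range.1 hj)

/-- Coefficients of `F_a(t)_{<p^{n+1}} · F_{a'}(t^{-p})_{<p^{n+1}}`. -/
noncomputable def CC (p : ℕ) [Fact p.Prime] (q : ℕ) (m : ℤ) (A A' : ℕ → ℤ_[p]) : ℤ_[p] :=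
  ∑ i ∈ Finset.range (p * q), ∑ j ∈ Finset.range q,
    if (i : ℤ) - p * j = m then A i * A' j else 0

theorem Setup.final (S : Setup p a a' l A A' V) {n : ℕ} (hc : Claim p n a' A') (m : ℤ) :
    (p : ℤ_[p]) ^ (n + 1) ∣ CC p (p ^ n) m A A' - CC p (p ^ n) (l - m) A A' := by
  unfold CC
  rw [sum_digits, sum_digits, ← sum_sig S.hl (fun i0 => ∑ i1 ∈ Finset.range (p ^ n),
    ∑ j ∈ Finset.range (p ^ n), if ((i0 + p * i1 : ℕ) : ℤ) - p * j = l - m then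
      A (i0 + p * i1) * A' j else 0), ← Finset.sum_sub_distrib]
  refine Finset.dvd_sum fun i0 hi => ?_
  rw [Finset.mem_range] at hi
  have h1 := S.shift n i0 hi (fun x => ∑ j ∈ Finset.range (p ^ n),
    if ((i0 : ℤ) - p * ee l i0) + p * ((x : ℤ) - j) = m then A' j else 0)
  have h2 := core hc ((i0 : ℤ) - p * ee l i0) m (Φ := fun X _ => WW p l V i0 X)
    (fun d x x' y y' hx _ => S.WW_lip i0 d x x' hx)
  have := dvd_add h1 h2
  convert this using 1
  have e1 : ∀ x y z w u v : ℤ_[p], x = u → y = v → z = w → x - y = u - z + (w - v) := by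
    intros; subst_vars; ring
  apply e1
  · refine Finset.sum_congr rfl fun i _ => ?_
    rw [Finset.mul_sum]
    refine Finset.sum_congr rfl fun j _ => ?_
    rw [mul_ite, mul_zero]
    apply if_congr _ rfl rfl
    push_cast
    constructor <;> intro h <;> linarith
  · unfold UU
    rw [Finset.sum_comm]
    refine Finset.sum_congr rfl fun x _ => Finset.sum_congr rfl fun y _ => ?_
    beta_reduce
    rw [S.WW_refl hi, S.A_eq_VV _ _ (sig_lt S.hl hi)]
    apply if_congr _ (by ring) rfl
    push_cast
    rw [sig_cast hi]
    constructor <;> intro h <;> linarith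
  · unfold UU
    refine Finset.sum_congr rfl fun x _ => ?_
    rw [Finset.mul_sum]
    refine Finset.sum_congr rfl fun y _ => ?_
    rw [mul_ite, mul_zero]
    apply if_congr Iff.rfl _ rfl
    ring

end

theorem exists_setup {p : ℕ} [Fact p.Prime] {a a' : ℤ_[p]} {A A' : ℕ → ℤ_[p]}
    (hD : IsDworkPrime p a a') (hA : IsHGCoeff p 2 a A) (hA' : IsHGCoeff p 2 a' A') :
    ∃ V, Setup p a a' (dl p a) A A' V := by
  obtain ⟨V, h1, h2, h3, h4⟩ := exists_V p a
  refine ⟨V, ⟨hD, ?_, Rec.of_coeff hA, Rec.of_coeff hA', h1, h2, h3, h4⟩⟩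
  have := PadicInt.appr_lt (-a) 1
  rwa [pow_one] at this

theorem claim_all {p : ℕ} [Fact p.Prime] (as : ℕ → ℤ_[p])
    (hasD : ∀ i, IsDworkPrime p (as i) (as (i + 1)))
    (AF : ℕ → ℕ → ℤ_[p]) (hAF : ∀ i, IsHGCoeff p 2 (as i) (AF i)) (n : ℕ) :
    ∀ i, Claim p n (as i) (AF i) := by
  induction n with
  | zero => intro i m Ψ _; simp
  | succ n ih =>
    intro i
    obtain ⟨V, S⟩ := exists_setup (hasD i) (hAF i) (hAF (i + 1))
    exact S.claim_succ (ih (i + 1))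

open LaurentPolynomial in
theorem laurent_trunc (p : ℕ) [Fact p.Prime] (n : ℕ) (B : ℕ → Wp p) (q : ℕ) :
    laurentOfPolyW p n ((PowerSeries.mk B).trunc q) =
      ∑ k ∈ Finset.range q,
        C (Ideal.Quotient.mk (Ideal.span {(p : Wp p) ^ n}) (B k)) * T (k : ℤ) := by
  have e : (PowerSeries.mk B).trunc q = ∑ k ∈ Finset.range q, Polynomial.monomial k (B k) := by
    ext d
    rw [PowerSeries.coeff_trunc, Polynomial.finset_sum_coeff]
    simp [Polynomial.coeff_monomial]
  rw [e, map_sum]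
  refine Finset.sum_congr rfl fun k _ => ?_
  rw [laurentOfPolyW, RingHom.comp_apply, Polynomial.coe_mapRingHom, Polynomial.map_monomial,
    ← Polynomial.C_mul_X_pow_eq_monomial, Polynomial.toLaurent_C_mul_X_pow]

open LaurentPolynomial in
theorem laurent_trunc_p (p : ℕ) [Fact p.Prime] (n : ℕ) (B : ℕ → Wp p) (q : ℕ) :
    laurentOfPolyW p n ((PowerSeries.mk (fun m => if p ∣ m then B (m / p) else 0)).trunc (p * q)) =
      ∑ j ∈ Finset.range q,
        C (Ideal.Quotient.mk (Ideal.span {(p : Wp p) ^ n}) (B j)) * T ((p : ℤ) * j) := by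
  have hp := (Fact.out : p.Prime).pos
  rw [laurent_trunc, sum_digits, Finset.sum_eq_single_of_mem 0 (Finset.mem_range.2 hp)]
  · refine Finset.sum_congr rfl fun j _ => ?_
    rw [zero_add, if_pos (dvd_mul_right _ _), Nat.mul_div_cancel_left _ hp]
    push_cast
    rfl
  · intro i0 hi h0
    refine Finset.sum_eq_zero fun j _ => ?_
    rw [if_neg, map_zero, map_zero, zero_mul]
    rw [(Nat.dvd_add_iff_left (dvd_mul_right p j)).symm]
    intro hd
    have := Nat.le_of_dvd (Nat.pos_of_ne_zero h0) hd
    have := Finset.mem_range.1 hi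
    omega

open LaurentPolynomial in
theorem laurent_identity {R : Type*} [CommRing R] {p : ℕ} [Fact p.Prime] (φ : ℤ_[p] →+* R)
    (n : ℕ) (hφ : φ ((p : ℤ_[p]) ^ (n + 1)) = 0) (l : ℕ) (A A' : ℕ → ℤ_[p])
    (h : ∀ m : ℤ, (p : ℤ_[p]) ^ (n + 1) ∣ CC p (p ^ n) m A A' - CC p (p ^ n) (l - m) A A') :
    (∑ k ∈ Finset.range (p * p ^ n), C (φ (A k)) * T (k : ℤ)) *
      invert (∑ j ∈ Finset.range (p ^ n), C (φ (A' j)) * T ((p : ℤ) * j)) =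
    T (l : ℤ) * invert (∑ k ∈ Finset.range (p * p ^ n), C (φ (A k)) * T (k : ℤ)) *
      ∑ j ∈ Finset.range (p ^ n), C (φ (A' j)) * T ((p : ℤ) * j) := by
  have e1 : (∑ k ∈ Finset.range (p * p ^ n), C (φ (A k)) * T (k : ℤ)) *
      invert (∑ j ∈ Finset.range (p ^ n), C (φ (A' j)) * T ((p : ℤ) * j)) =
      ∑ k ∈ Finset.range (p * p ^ n), ∑ j ∈ Finset.range (p ^ n),
        (AddMonoidAlgebra.single ((k : ℤ) - p * j) (φ (A k * A' j)) : LaurentPolynomial R) := by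
    rw [map_sum, Finset.sum_mul_sum]
    refine Finset.sum_congr rfl fun k _ => Finset.sum_congr rfl fun j _ => ?_
    rw [single_eq_C_mul_T, map_mul, invert_C, invert_T, map_mul, map_mul, T_sub]
    ring
  have e2 : T (l : ℤ) * invert (∑ k ∈ Finset.range (p * p ^ n), C (φ (A k)) * T (k : ℤ)) *
      ∑ j ∈ Finset.range (p ^ n), C (φ (A' j)) * T ((p : ℤ) * j) =
      ∑ k ∈ Finset.range (p * p ^ n), ∑ j ∈ Finset.range (p ^ n),
        (AddMonoidAlgebra.single ((l : ℤ) - k + p * j) (φ (A k * A' j)) : LaurentPolynomial R) := by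
    rw [map_sum, mul_assoc, Finset.sum_mul_sum, Finset.mul_sum]
    refine Finset.sum_congr rfl fun k _ => ?_
    rw [Finset.mul_sum]
    refine Finset.sum_congr rfl fun j _ => ?_
    rw [single_eq_C_mul_T, map_mul, invert_C, invert_T, map_mul, map_mul, T_add, T_sub]
    ring
  rw [e1, e2]
  ext m
  obtain ⟨c, hc⟩ := h m
  have h1 := congrArg φ hc
  rw [map_mul, hφ, zero_mul, map_sub, sub_eq_zero] at h1
  unfold CC at h1
  simp only [map_sum, apply_ite φ, map_zero] at h1
  simp only [AddMonoidAlgebra.coeff_sum, Finsupp.coe_finsetSum, Finset.sum_apply,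
    AddMonoidAlgebra.coeff_single, Finsupp.single_apply]
  rw [h1]
  refine Finset.sum_congr rfl fun k _ => Finset.sum_congr rfl fun j _ => ?_
  apply if_congr _ rfl rfl
  constructor <;> intro h <;> linarith

set_option synthInstance.maxHeartbeats 800000 in
set_option maxHeartbeats 1600000 in
/-- transformation formula for Dwork's `p`-adic hypergeometric function:
for `a = m₀/N`, `p > N`, `s = 2`, one has `ℱ^Dw_{a,a}(t) = t^l ℱ^Dw_{a,a}(t⁻¹)` in
`W⟨t,t⁻¹,h(t)⁻¹⟩`; concretely, for every `n ≥ 1`,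
`F_{a,a}(t)_{<p^n} · ω_n([F_{a′,a′}(t^p)]_{<p^n}) =
t^l · ω_n(F_{a,a}(t)_{<p^n}) · [F_{a′,a′}(t^p)]_{<p^n}` in `R_n`. -/
theorem statement18 (p : ℕ) [Fact p.Prime] (N : ℕ) (hN : 2 ≤ N) (hpN : N < p)
    (m₀ : ℕ) (hm₀ : 0 < m₀) (hm₀N : m₀ < N)
    (a : ℤ_[p]) (haN : (N : ℤ_[p]) * a = (m₀ : ℤ_[p]))
    (as : ℕ → ℤ_[p]) (has0 : as 0 = a) (hasD : ∀ i, IsDworkPrime p (as i) (as (i + 1)))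
    (r : ℕ) (hr : 1 ≤ r) (har : as r = a)
    (AF : ℕ → ℕ → ℤ_[p]) (hAF : ∀ i, IsHGCoeff p 2 (as i) (AF i))
    (hW : Polynomial (Wp p))
    (hhW : hW = (∏ i ∈ Finset.range r, (PowerSeries.mk (AF i)).trunc p).map (iota p)) :
    ∀ n : ℕ, 1 ≤ n → ∀ ω : Rn p hW n →+* Rn p hW n,
      (∀ f : LaurentPolynomial (Qn p n),
        ω (mkRn p hW n f) = mkRn p hW n (LaurentPolynomial.invert f)) →
      toRn p hW n ((PowerSeries.mk (fun k => iota p (AF 0 k))).trunc (p ^ n)) *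
          ω (toRn p hW n ((PowerSeries.mk
            (fun m => if p ∣ m then iota p (AF 1 (m / p)) else 0)).trunc (p ^ n))) =
        mkRn p hW n (LaurentPolynomial.T (dl p a : ℤ)) *
          ω (toRn p hW n ((PowerSeries.mk (fun k => iota p (AF 0 k))).trunc (p ^ n))) *
          toRn p hW n ((PowerSeries.mk
            (fun m => if p ∣ m then iota p (AF 1 (m / p)) else 0)).trunc (p ^ n)) := by
  intro n hn ω hω
  obtain ⟨n, rfl⟩ : ∃ k, n = k + 1 := ⟨n - 1, by omega⟩
  obtain ⟨V, S⟩ := exists_setup (hasD 0) (hAF 0) (hAF 1)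
  have hc := fun m => S.final (claim_all as hasD AF hAF n 1) m
  rw [has0] at hc
  unfold toRn
  simp only [RingHom.comp_apply]
  rw [hω, hω, ← map_mul, ← map_mul, ← map_mul]
  congr 1
  rw [pow_succ' p n, laurent_trunc,
    laurent_trunc_p p (n + 1) (fun j => iota p (AF 1 j)) (p ^ n)]
  refine laurent_identity
    ((Ideal.Quotient.mk (Ideal.span {(p : Wp p) ^ (n + 1)})).comp (iota p)) n ?_ (dl p a)
    (AF 0) (AF 1) hc
  rw [RingHom.comp_apply, map_pow, map_natCast, Ideal.Quotient.eq_zero_iff_mem]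
  exact Ideal.mem_span_singleton_self _

end HGP
end
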